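/- arXiv:0906.1560 — 4 statements merged into one kernel-verified Lean document; each statement's English description precedes it below -/
import Mathlib

section
/- Let ℓ₁₂, ℓ₁₃, ℓ₂₃ be positive reals satisfying the strict triangle inequalities and let d be a metric (d_ij + d_ji = ℓ_ij and d₁₂² + d₂₃² + d₃₁² = d₂₁² + d₃₂² + d₁₃²). Fix δ ∈ ℝ and consider the length variation ℓ₁₂(t) = ℓ₁₂, ℓ₁₃(t) = ℓ₁₃ + t d₃₁ δ, ℓ₂₃(t) = ℓ₂₃ + t d₃₂ δ. Then the angles γ_{i,jk}(t) defined by the law of cosines satisfy, at t = 0: (d/dt) γ_{1,23} = (h_{13,2}/ℓ₁₃) δ, (d/dt) γ_{2,13} = (h_{23,1}/ℓ₂₃) δ, and (d/dt) γ_{3,12} = −(h_{13,2}/ℓ₁₃ + h_{23,1}/ℓ₂₃) δ, where h_{13,2} = (d₁₂ − d₁₃ cos γ_{1,23})/sin γ_{1,23} and h_{23,1} = (d₂₁ − d₂₃ cos γ_{2,13})/sin γ_{2,13}. -/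
/-- The angle at the vertex of a Euclidean triangle whose two adjacent sides have
lengths `a`, `b` and whose opposite side has length `c` (law of cosines). -/
noncomputable def triAngle (a b c : ℝ) : ℝ :=
  Real.arccos ((a ^ 2 + b ^ 2 - c ^ 2) / (2 * a * b))

/-- The square of the sine of an angle of a triangle with sides `a`, `b`, `c`, in terms of four
times the area `K`. -/
theorem one_sub_lawOfCosines_sq {a b c K : ℝ} (ha : 0 < a) (hb : 0 < b)
    (hK : K ^ 2 = 4 * a ^ 2 * b ^ 2 - (a ^ 2 + b ^ 2 - c ^ 2) ^ 2) :
    1 - ((a ^ 2 + b ^ 2 - c ^ 2) / (2 * a * b)) ^ 2 = (K / (2 * a * b)) ^ 2 := by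
  field_simp
  linarith

theorem sin_triAngle {a b c K : ℝ} (ha : 0 < a) (hb : 0 < b) (hK₀ : 0 < K)
    (hK : K ^ 2 = 4 * a ^ 2 * b ^ 2 - (a ^ 2 + b ^ 2 - c ^ 2) ^ 2) :
    Real.sin (triAngle a b c) = K / (2 * a * b) := by
  rw [triAngle, Real.sin_arccos, one_sub_lawOfCosines_sq ha hb hK, Real.sqrt_sq (by positivity)]

theorem abs_lawOfCosines_lt_one {a b c K : ℝ} (ha : 0 < a) (hb : 0 < b) (hK₀ : 0 < K)
    (hK : K ^ 2 = 4 * a ^ 2 * b ^ 2 - (a ^ 2 + b ^ 2 - c ^ 2) ^ 2) :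
    |(a ^ 2 + b ^ 2 - c ^ 2) / (2 * a * b)| < 1 := by
  rw [← sq_lt_one_iff_abs_lt_one, ← sub_pos, one_sub_lawOfCosines_sq ha hb hK]
  positivity

theorem cos_triAngle {a b c K : ℝ} (ha : 0 < a) (hb : 0 < b) (hK₀ : 0 < K)
    (hK : K ^ 2 = 4 * a ^ 2 * b ^ 2 - (a ^ 2 + b ^ 2 - c ^ 2) ^ 2) :
    Real.cos (triAngle a b c) = (a ^ 2 + b ^ 2 - c ^ 2) / (2 * a * b) := by
  have h := abs_lt.1 (abs_lawOfCosines_lt_one ha hb hK₀ hK)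
  rw [triAngle, Real.cos_arccos h.1.le h.2.le]

/-- The derivative of an angle of a triangle whose sides vary differentiably; `K` is four times
the area of the triangle at time `t`. -/
theorem HasDerivAt.triAngle {f g h : ℝ → ℝ} {f' g' h' t K : ℝ}
    (hf : HasDerivAt f f' t) (hg : HasDerivAt g g' t) (hh : HasDerivAt h h' t)
    (hft : 0 < f t) (hgt : 0 < g t) (hK₀ : 0 < K)
    (hK : K ^ 2 = 4 * f t ^ 2 * g t ^ 2 - (f t ^ 2 + g t ^ 2 - h t ^ 2) ^ 2) :
    HasDerivAt (fun s => triAngle (f s) (g s) (h s))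
      ((2 * (h t * h' - f t * f' - g t * g') +
        (f' / f t + g' / g t) * (f t ^ 2 + g t ^ 2 - h t ^ 2)) / K) t := by
  have habs := abs_lt.1 (abs_lawOfCosines_lt_one hft hgt hK₀ hK)
  have hquot : HasDerivAt (fun s => (f s ^ 2 + g s ^ 2 - h s ^ 2) / (2 * f s * g s)) _ t :=
    (((hf.fun_pow 2).fun_add (hg.fun_pow 2)).fun_sub (hh.fun_pow 2)).fun_div
      ((hf.const_mul 2).fun_mul hg) (by positivity)
  have hcomp := (Real.hasDerivAt_arccos habs.1.ne' habs.2.ne).comp t hquot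
  refine hcomp.congr_deriv ?_
  rw [one_sub_lawOfCosines_sq hft hgt hK, Real.sqrt_sq (by positivity)]
  field_simp
  ring

/-- Under the variation `ℓ₁₂(t) = ℓ₁₂`, `ℓ₁₃(t) = ℓ₁₃ + t d₃₁ δ`,
`ℓ₂₃(t) = ℓ₂₃ + t d₃₂ δ` of a triangle with a metric `d`, at `t = 0` the angles satisfy
`γ₁' = (h_{13,2}/ℓ₁₃) δ`, `γ₂' = (h_{23,1}/ℓ₂₃) δ`,
`γ₃' = −(h_{13,2}/ℓ₁₃ + h_{23,1}/ℓ₂₃) δ`. -/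
theorem angle_variation_2d
    (ℓ₁₂ ℓ₁₃ ℓ₂₃ : ℝ)
    (h₁₂pos : 0 < ℓ₁₂) (h₁₃pos : 0 < ℓ₁₃) (h₂₃pos : 0 < ℓ₂₃)
    (htri1 : ℓ₁₂ < ℓ₁₃ + ℓ₂₃) (htri2 : ℓ₁₃ < ℓ₁₂ + ℓ₂₃) (htri3 : ℓ₂₃ < ℓ₁₂ + ℓ₁₃)
    (d₁₂ d₂₁ d₁₃ d₃₁ d₂₃ d₃₂ : ℝ)
    (hsum12 : d₁₂ + d₂₁ = ℓ₁₂) (hsum13 : d₁₃ + d₃₁ = ℓ₁₃) (hsum23 : d₂₃ + d₃₂ = ℓ₂₃)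
    (hmetric : d₁₂ ^ 2 + d₂₃ ^ 2 + d₃₁ ^ 2 = d₂₁ ^ 2 + d₃₂ ^ 2 + d₁₃ ^ 2)
    (δ : ℝ) :
    let γ₁ := triAngle ℓ₁₂ ℓ₁₃ ℓ₂₃
    let γ₂ := triAngle ℓ₁₂ ℓ₂₃ ℓ₁₃
    let h132 := (d₁₂ - d₁₃ * Real.cos γ₁) / Real.sin γ₁
    let h231 := (d₂₁ - d₂₃ * Real.cos γ₂) / Real.sin γ₂
    HasDerivAt (fun t : ℝ => triAngle ℓ₁₂ (ℓ₁₃ + t * (d₃₁ * δ)) (ℓ₂₃ + t * (d₃₂ * δ)))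
      (h132 / ℓ₁₃ * δ) 0
    ∧ HasDerivAt (fun t : ℝ => triAngle ℓ₁₂ (ℓ₂₃ + t * (d₃₂ * δ)) (ℓ₁₃ + t * (d₃₁ * δ)))
      (h231 / ℓ₂₃ * δ) 0
    ∧ HasDerivAt (fun t : ℝ => triAngle (ℓ₁₃ + t * (d₃₁ * δ)) (ℓ₂₃ + t * (d₃₂ * δ)) ℓ₁₂)
      (-(h132 / ℓ₁₃ + h231 / ℓ₂₃) * δ) 0 := by
  intro γ₁ γ₂ h132 h231
  obtain ⟨K, hK₀, hK⟩ : ∃ K : ℝ, 0 < K ∧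
      K ^ 2 = 4 * ℓ₁₂ ^ 2 * ℓ₁₃ ^ 2 - (ℓ₁₂ ^ 2 + ℓ₁₃ ^ 2 - ℓ₂₃ ^ 2) ^ 2 := by
    have hpos : 0 < 4 * ℓ₁₂ ^ 2 * ℓ₁₃ ^ 2 - (ℓ₁₂ ^ 2 + ℓ₁₃ ^ 2 - ℓ₂₃ ^ 2) ^ 2 := by
      have h := mul_pos (mul_pos (mul_pos (add_pos (add_pos h₁₂pos h₁₃pos) h₂₃pos)
        (sub_pos.2 htri1)) (sub_pos.2 htri2)) (sub_pos.2 htri3)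
      linear_combination h
    exact ⟨√_, Real.sqrt_pos.2 hpos, Real.sq_sqrt hpos.le⟩
  have hK₂ : K ^ 2 = 4 * ℓ₁₂ ^ 2 * ℓ₂₃ ^ 2 - (ℓ₁₂ ^ 2 + ℓ₂₃ ^ 2 - ℓ₁₃ ^ 2) ^ 2 := by
    rw [hK]; ring
  have hK₃ : K ^ 2 = 4 * ℓ₁₃ ^ 2 * ℓ₂₃ ^ 2 - (ℓ₁₃ ^ 2 + ℓ₂₃ ^ 2 - ℓ₁₂ ^ 2) ^ 2 := by
    rw [hK]; ring
  have hline (a v : ℝ) : HasDerivAt (fun t : ℝ => a + t * v) v 0 := by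
    simpa using ((hasDerivAt_id (0 : ℝ)).mul_const v).const_add a
  have hconst : HasDerivAt (fun _ : ℝ => ℓ₁₂) 0 0 := hasDerivAt_const _ _
  have hℓ₁₃ := hline ℓ₁₃ (d₃₁ * δ)
  have hℓ₂₃ := hline ℓ₂₃ (d₃₂ * δ)
  have hh132 : h132 = (2 * ℓ₁₂ * ℓ₁₃ * d₁₂ - d₁₃ * (ℓ₁₂ ^ 2 + ℓ₁₃ ^ 2 - ℓ₂₃ ^ 2)) / K := by
    simp only [h132, γ₁, sin_triAngle h₁₂pos h₁₃pos hK₀ hK, cos_triAngle h₁₂pos h₁₃pos hK₀ hK]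
    field_simp
  have hh231 : h231 = (2 * ℓ₁₂ * ℓ₂₃ * d₂₁ - d₂₃ * (ℓ₁₂ ^ 2 + ℓ₂₃ ^ 2 - ℓ₁₃ ^ 2)) / K := by
    simp only [h231, γ₂, sin_triAngle h₁₂pos h₂₃pos hK₀ hK₂, cos_triAngle h₁₂pos h₂₃pos hK₀ hK₂]
    field_simp
  have hm : 2 * (ℓ₂₃ * d₃₂ - ℓ₁₃ * d₃₁ - ℓ₁₂ * d₁₂) + (ℓ₁₂ ^ 2 + ℓ₁₃ ^ 2 - ℓ₂₃ ^ 2) = 0 := by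
    subst hsum12 hsum13 hsum23
    linear_combination -hmetric
  have hd₁₃ : d₁₃ = ℓ₁₃ - d₃₁ := by linarith
  have hd₂₃ : d₂₃ = ℓ₂₃ - d₃₂ := by linarith
  have hd₂₁ : d₂₁ = ℓ₁₂ - d₁₂ := by linarith
  rw [hh132, hh231]
  refine ⟨?_, ?_, ?_⟩
  · refine (hconst.triAngle hℓ₁₃ hℓ₂₃ (K := K) (by simpa) (by simpa) hK₀
      (by simpa using hK)).congr_deriv ?_
    rw [hd₁₃]
    simp only [zero_mul, mul_zero, zero_div, add_zero, zero_add, sub_zero]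
    field_simp
    linear_combination δ * ℓ₁₃ * hm
  · refine (hconst.triAngle hℓ₂₃ hℓ₁₃ (K := K) (by simpa) (by simpa) hK₀
      (by simpa using hK₂)).congr_deriv ?_
    rw [hd₂₃, hd₂₁]
    simp only [zero_mul, mul_zero, zero_div, add_zero, zero_add, sub_zero]
    field_simp
    linear_combination -δ * ℓ₂₃ * hm
  · refine (hℓ₁₃.triAngle hℓ₂₃ hconst (K := K) (by simpa) (by simpa) hK₀
      (by simpa using hK₃)).congr_deriv ?_
    rw [hd₁₃, hd₂₃, hd₂₁]
    simp only [zero_mul, mul_zero, add_zero]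
    field_simp
    ring
end

section
/- Given a conformal structure on an open, simply connected set U ⊆ ℝ^V for a triangle collection 𝒯, there exists a smooth function F : U → ℝ such that ∂F/∂f_i = K_i on U for every vertex i ∈ V. -/
open Finset

/-- `{i, j}` is an edge of the triangle collection `𝒯`. -/
def IsEdge {V : Type*} [DecidableEq V] (𝒯 : Finset (Finset V)) (i j : V) : Prop :=
  i ≠ j ∧ ∃ T ∈ 𝒯, i ∈ T ∧ j ∈ T

instance {V : Type*} [DecidableEq V] (𝒯 : Finset (Finset V)) (i j : V) :
    Decidable (IsEdge 𝒯 i j) := by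
  unfold IsEdge; infer_instance

/-- A (two-dimensional) conformal structure on an open set `U ⊆ ℝ^V` for a collection
`𝒯` of triangles: a smooth assignment `f ↦ d f i j` of reals to ordered edges, where
`d f i j` depends only on the coordinates `f i` and `f j`, the induced lengths
`ℓ i j = d i j + d j i` are positive and satisfy the strict triangle inequality on each
triangle, the metric condition holds on each triangle, and `∂ℓ_ij/∂f_i = d_ij`. -/
structure Conformal2D (V : Type*) [Fintype V] [DecidableEq V]
    (𝒯 : Finset (Finset V)) (U : Set (V → ℝ)) where
  d : (V → ℝ) → V → V → ℝ
  openU : IsOpen U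
  card3 : ∀ T ∈ 𝒯, T.card = 3
  smooth : ∀ i j, IsEdge 𝒯 i j → ContDiffOn ℝ (⊤ : ℕ∞) (fun f => d f i j) U
  localDep : ∀ i j, IsEdge 𝒯 i j → ∀ f g : V → ℝ, f i = g i → f j = g j →
    d f i j = d g i j
  lenPos : ∀ f ∈ U, ∀ i j, IsEdge 𝒯 i j → 0 < d f i j + d f j i
  triIneq : ∀ f ∈ U, ∀ T ∈ 𝒯, ∀ i ∈ T, ∀ j ∈ T, ∀ k ∈ T, i ≠ j → i ≠ k → j ≠ k →
    d f i j + d f j i < (d f i k + d f k i) + (d f j k + d f k j)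
  metricCond : ∀ f ∈ U, ∀ T ∈ 𝒯, ∀ i ∈ T, ∀ j ∈ T, ∀ k ∈ T, i ≠ j → i ≠ k → j ≠ k →
    d f i j ^ 2 + d f j k ^ 2 + d f k i ^ 2 = d f j i ^ 2 + d f k j ^ 2 + d f i k ^ 2
  derivLen : ∀ i j, IsEdge 𝒯 i j → ∀ f ∈ U,
    HasDerivAt (fun s : ℝ =>
        d (Function.update f i s) i j + d (Function.update f i s) j i)
      (d f i j) (f i)

namespace Conformal2D

variable {V : Type*} [Fintype V] [DecidableEq V] {𝒯 : Finset (Finset V)}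
  {U : Set (V → ℝ)}

/-- The length `ℓ_ij = d_ij + d_ji`. -/
noncomputable def len (C : Conformal2D V 𝒯 U) (f : V → ℝ) (i j : V) : ℝ :=
  C.d f i j + C.d f j i

/-- The angle `γ_{i,jk}` at vertex `i` in the triangle `{i, j, k}`. -/
noncomputable def ang (C : Conformal2D V 𝒯 U) (f : V → ℝ) (i j k : V) : ℝ :=
  triAngle (C.len f i j) (C.len f i k) (C.len f j k)

/-- `h_{ij,k} = (d_ik − d_ij cos γ_{i,jk}) / sin γ_{i,jk}`. -/
noncomputable def hh (C : Conformal2D V 𝒯 U) (f : V → ℝ) (i j k : V) : ℝ :=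
  (C.d f i k - C.d f i j * Real.cos (C.ang f i j k)) / Real.sin (C.ang f i j k)

/-- The curvature `K_i = 2π − Σ_{{i,j,k} ∈ 𝒯} γ_{i,jk}` (each unordered triangle
containing `i` counted once; the ordered double sum counts it twice, whence `1/2`). -/
noncomputable def K (C : Conformal2D V 𝒯 U) (f : V → ℝ) (i : V) : ℝ :=
  2 * Real.pi - (1 / 2) * ∑ j : V, ∑ k : V,
    if ({i, j, k} : Finset V) ∈ 𝒯 ∧ i ≠ j ∧ i ≠ k ∧ j ≠ k then C.ang f i j k else 0

/-- The dual length `ℓ*_ij = Σ_{{i,j,k} ∈ 𝒯} h_{ij,k}`. -/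
noncomputable def dualLen (C : Conformal2D V 𝒯 U) (f : V → ℝ) (i j : V) : ℝ :=
  ∑ k : V,
    if ({i, j, k} : Finset V) ∈ 𝒯 ∧ i ≠ j ∧ i ≠ k ∧ j ≠ k then C.hh f i j k else 0

end Conformal2D

/-- A copy of `G` carrying the discrete topology. -/
def DiscreteCopy (G : Type*) : Type _ := G

instance (G : Type*) : TopologicalSpace (DiscreteCopy G) := ⊥

instance (G : Type*) : DiscreteTopology (DiscreteCopy G) := ⟨rfl⟩

section Primitive

variable {E G : Type*} [NormedAddCommGroup E] [NormedSpace ℝ E]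
  [NormedAddCommGroup G] [NormedSpace ℝ G]

/-- Two primitives of the same 1-form on a convex open set differ by a constant. -/
theorem Convex.exists_sub_eq_of_hasFDerivAt {s : Set E} (hs : Convex ℝ s) (hso : IsOpen s)
    {ω : E → E →L[ℝ] G} {g h : E → G} (hg : ∀ x ∈ s, HasFDerivAt g (ω x) x)
    (hh : ∀ x ∈ s, HasFDerivAt h (ω x) x) : ∃ c, ∀ x ∈ s, g x - h x = c := by
  have hd : ∀ x ∈ s, HasFDerivAt (fun y => g y - h y) (0 : E →L[ℝ] G) x := fun x hx => by
    simpa using (hg x hx).fun_sub (hh x hx)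
  rcases s.eq_empty_or_nonempty with rfl | ⟨a, ha⟩
  · exact ⟨0, by simp⟩
  · refine ⟨g a - h a, fun x hx => ?_⟩
    refine hs.is_const_of_fderivWithin_eq_zero (𝕜 := ℝ)
      (fun y hy => (hd y hy).differentiableAt.differentiableWithinAt) (fun y hy => ?_) hx ha
    rw [fderivWithin_of_isOpen hso hy, (hd y hy).fderiv]

/-- The bundle of germs of primitives of a 1-form: local primitives `g x` on convex open
neighbourhoods `B x` of the points of `U` serve as trivializations. -/
def primitiveBundleCore {U : Set E} (ω : E → E →L[ℝ] G) (B : U → Set E) (g : U → E → G)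
    (hBo : ∀ x, IsOpen (B x)) (hBc : ∀ x, Convex ℝ (B x)) (hxB : ∀ x : U, (x : E) ∈ B x)
    (hg : ∀ x, ∀ y ∈ B x, HasFDerivAt (g x) (ω y) y) :
    FiberBundleCore U U (DiscreteCopy G) where
  baseSet x := Subtype.val ⁻¹' B x
  isOpen_baseSet x := (hBo x).preimage continuous_subtype_val
  indexAt x := x
  mem_baseSet_at x := hxB x
  coordChange x y b v := (show G from v) + (g x b - g y b)
  coordChange_self x b _ v := by
    change (show G from v) + (g x b - g x b) = v
    rw [sub_self, add_zero]
  continuousOn_coordChange x y := by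
    obtain ⟨c, hc⟩ := ((hBc x).inter (hBc y)).exists_sub_eq_of_hasFDerivAt
      ((hBo x).inter (hBo y)) (fun z hz => hg x z hz.1) (fun z hz => hg y z hz.2)
    let T : DiscreteCopy G → DiscreteCopy G := fun v => (show G from v) + c
    have hT : Continuous T := continuous_of_discreteTopology
    refine (hT.comp continuous_snd).continuousOn.congr ?_
    rintro ⟨b, v⟩ ⟨hb, -⟩
    change (show G from v) + (g x b - g y b) = (show G from v) + c
    rw [hc b hb]
  coordChange_comp x y z b _ v := by
    change (show G from v) + (g x b - g y b) + (g y b - g z b)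
      = (show G from v) + (g x b - g z b)
    abel

/-- **Poincaré lemma for 1-forms**: a closed 1-form on a simply connected open set is exact. -/
theorem exists_hasFDerivAt_of_fderiv_symmetric_of_simplyConnected {U : Set E} (hU : IsOpen U)
    [SimplyConnectedSpace U] [CompleteSpace G] {ω : E → E →L[ℝ] G} (hω : DifferentiableOn ℝ ω U)
    (hsymm : ∀ x ∈ U, ∀ v w, fderiv ℝ ω x v w = fderiv ℝ ω x w v) :
    ∃ F : E → G, ∀ x ∈ U, HasFDerivAt F (ω x) x := by
  classical
  have hloc : ∀ x : U, ∃ B : Set E, IsOpen B ∧ Convex ℝ B ∧ (x : E) ∈ B ∧ B ⊆ U ∧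
      ∃ g : E → G, ∀ y ∈ B, HasFDerivAt g (ω y) y := by
    intro x
    obtain ⟨r, hr, hrU⟩ := Metric.isOpen_iff.1 hU x x.2
    exact ⟨Metric.ball x r, Metric.isOpen_ball, convex_ball _ _, Metric.mem_ball_self hr, hrU,
      (convex_ball _ _).exists_forall_hasFDerivAt_of_fderiv_symmetric Metric.isOpen_ball
        (hω.mono hrU) fun a ha => hsymm a (hrU ha)⟩
  choose B hBo hBc hxB hBU g hg using hloc
  let Z := primitiveBundleCore ω B g hBo hBc hxB hg
  have cov : IsCoveringMap Z.proj := FiberBundle.isCoveringMap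
  have := hU.locallyPathConnectedSpace
  obtain ⟨a₀⟩ : Nonempty U := inferInstance
  obtain ⟨s, ⟨-, hs⟩, -⟩ := cov.existsUnique_continuousMap_lifts (ContinuousMap.id U) a₀
    (⟨a₀, (0 : G)⟩ : Z.TotalSpace) rfl
  have hs' : ∀ x, (s x).1 = x := fun x => congrFun hs x
  let coord : U → U → G := fun x y => (Z.localTriv x (s y)).2
  have hcoord : ∀ x y, coord x y = coord y y + (g y y - g x y) := by
    intro x y
    have h1 : coord x y = (show G from (s y).2) + (g (s y).1 (s y).1 - g x (s y).1) := rfl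
    have h2 : coord y y = (show G from (s y).2) + (g (s y).1 (s y).1 - g y (s y).1) := rfl
    rw [h1, h2, hs' y]
    abel
  let F : E → G := fun e => if h : e ∈ U then g ⟨e, h⟩ e + coord ⟨e, h⟩ ⟨e, h⟩ else 0
  refine ⟨F, fun x hx => ?_⟩
  have hcont : ContinuousAt (fun y => (Z.localTriv ⟨x, hx⟩ (s y)).2) ⟨x, hx⟩ := by
    refine continuousAt_snd.comp (ContinuousAt.comp ?_ s.continuous.continuousAt)
    refine (Z.localTriv ⟨x, hx⟩).continuousAt ?_
    rw [Z.mem_localTriv_source, hs']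
    exact hxB ⟨x, hx⟩
  have hev : ∀ᶠ y in nhds (⟨x, hx⟩ : U), coord ⟨x, hx⟩ y = coord ⟨x, hx⟩ ⟨x, hx⟩ :=
    hcont.eventually (IsOpen.mem_nhds (isOpen_discrete {_}) rfl)
  rw [nhds_subtype_eq_comap, Filter.eventually_comap] at hev
  refine ((hg ⟨x, hx⟩ x (hxB _)).add_const (coord ⟨x, hx⟩ ⟨x, hx⟩)).congr_of_eventuallyEq ?_
  filter_upwards [hev, hU.mem_nhds hx] with y hy hyU
  rw [← hy ⟨y, hyU⟩ rfl, hcoord]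
  simp only [F, dif_pos hyU]
  abel

end Primitive

section Angle

variable {a b c : ℝ}

/-- The strict triangle inequalities bound the quotient in the law of cosines. -/
theorem lawOfCosines_quotient_mem_Ioo (ha : 0 < a) (hb : 0 < b) (hc : 0 < c) (habc : a < b + c)
    (hbac : b < a + c) (hcab : c < a + b) :
    (a ^ 2 + b ^ 2 - c ^ 2) / (2 * a * b) ∈ Set.Ioo (-1 : ℝ) 1 := by
  have h : 0 < 2 * a * b := by positivity
  constructor
  · rw [lt_div_iff₀ h]
    nlinarith
  · rw [div_lt_iff₀ h]
    nlinarith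

variable {E : Type*} [NormedAddCommGroup E] [NormedSpace ℝ E] {α β γ : E → ℝ}
  {α' β' γ' : E →L[ℝ] ℝ} {x : E}

/-- The derivative of an angle of a Euclidean triangle in terms of the derivatives of its
side lengths; the square root is four times the area. -/
theorem HasFDerivAt.triAngle (hα : HasFDerivAt α α' x) (hβ : HasFDerivAt β β' x)
    (hγ : HasFDerivAt γ γ' x) (ha : 0 < α x) (hb : 0 < β x) (hc : 0 < γ x)
    (habc : α x < β x + γ x) (hbac : β x < α x + γ x) (hcab : γ x < α x + β x) :
    HasFDerivAt (fun y => triAngle (α y) (β y) (γ y))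
      ((√(2 * α x ^ 2 * β x ^ 2 + 2 * β x ^ 2 * γ x ^ 2 + 2 * γ x ^ 2 * α x ^ 2
          - α x ^ 4 - β x ^ 4 - γ x ^ 4))⁻¹ •
        ((2 * γ x) • γ' - ((α x ^ 2 - β x ^ 2 + γ x ^ 2) / α x) • α'
          - ((β x ^ 2 + γ x ^ 2 - α x ^ 2) / β x) • β')) x := by
  obtain ⟨h1, h2⟩ := lawOfCosines_quotient_mem_Ioo ha hb hc habc hbac hcab
  set q := (α x ^ 2 + β x ^ 2 - γ x ^ 2) / (2 * α x * β x) with hq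
  have hpos : 0 < 2 * α x * β x := by positivity
  have hS : 0 < √(1 - q ^ 2) := Real.sqrt_pos.2 (by nlinarith)
  have hD : √(2 * α x ^ 2 * β x ^ 2 + 2 * β x ^ 2 * γ x ^ 2 + 2 * γ x ^ 2 * α x ^ 2
      - α x ^ 4 - β x ^ 4 - γ x ^ 4) = 2 * α x * β x * √(1 - q ^ 2) := by
    rw [← Real.sqrt_sq hpos.le, ← Real.sqrt_mul (sq_nonneg _)]
    congr 1
    rw [hq]
    field_simp
    ring
  have hnum := ((hα.pow 2).add (hβ.pow 2)).sub (hγ.pow 2)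
  have hden := (hα.const_mul 2).mul hβ
  have hdiv := hnum.mul ((hasDerivAt_inv hpos.ne').comp_hasFDerivAt x hden)
  have := (Real.hasDerivAt_arccos h1.ne' h2.ne).comp_hasFDerivAt x hdiv
  refine HasFDerivAt.congr_fderiv this ?_
  rw [hD]
  ext v
  simp
  field_simp
  ring

theorem ContDiffAt.triAngle {n : WithTop ℕ∞} (hα : ContDiffAt ℝ n α x) (hβ : ContDiffAt ℝ n β x)
    (hγ : ContDiffAt ℝ n γ x) (ha : 0 < α x) (hb : 0 < β x) (hc : 0 < γ x)
    (habc : α x < β x + γ x) (hbac : β x < α x + γ x) (hcab : γ x < α x + β x) :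
    ContDiffAt ℝ n (fun y => triAngle (α y) (β y) (γ y)) x := by
  obtain ⟨h1, h2⟩ := lawOfCosines_quotient_mem_Ioo ha hb hc habc hbac hcab
  have hpos : 0 < 2 * α x * β x := by positivity
  exact (Real.contDiffAt_arccos h1.ne' h2.ne).comp x
    ((((hα.pow 2).add (hβ.pow 2)).sub (hγ.pow 2)).div ((contDiffAt_const.mul hα).mul hβ) hpos.ne')

end Angle

namespace Conformal2D

section IsTri

variable {V : Type*} [DecidableEq V] {𝒯 : Finset (Finset V)}

/-- `{i, j, k}` is a triangle of `𝒯` with distinct vertices `i`, `j`, `k`. -/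
def IsTri (𝒯 : Finset (Finset V)) (i j k : V) : Prop :=
  ({i, j, k} : Finset V) ∈ 𝒯 ∧ i ≠ j ∧ i ≠ k ∧ j ≠ k

instance (i j k : V) : Decidable (IsTri 𝒯 i j k) := by unfold IsTri; infer_instance

theorem IsTri.swap {i j k : V} (h : IsTri 𝒯 i j k) : IsTri 𝒯 j i k :=
  ⟨by rw [Finset.insert_comm]; exact h.1, h.2.1.symm, h.2.2.2, h.2.2.1⟩

theorem IsTri.swap_right {i j k : V} (h : IsTri 𝒯 i j k) : IsTri 𝒯 i k j :=
  ⟨by rw [Finset.pair_comm]; exact h.1, h.2.2.1, h.2.1, h.2.2.2.symm⟩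

theorem isTri_swap {i j k : V} : IsTri 𝒯 j i k ↔ IsTri 𝒯 i j k := ⟨IsTri.swap, IsTri.swap⟩

theorem isTri_rotate {i j k : V} : IsTri 𝒯 k i j ↔ IsTri 𝒯 i j k :=
  ⟨fun h => h.swap.swap_right, fun h => h.swap_right.swap⟩

theorem IsTri.isEdge {i j k : V} (h : IsTri 𝒯 i j k) : IsEdge 𝒯 i j :=
  ⟨h.2.1, _, h.1, by simp, by simp⟩

end IsTri

variable {V : Type*} [Fintype V] [DecidableEq V] {𝒯 : Finset (Finset V)} {U : Set (V → ℝ)}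

theorem len_comm (C : Conformal2D V 𝒯 U) (f : V → ℝ) (i j : V) : C.len f i j = C.len f j i :=
  add_comm _ _

theorem contDiffOn_len (C : Conformal2D V 𝒯 U) {i j : V} (hij : IsEdge 𝒯 i j)
    (hji : IsEdge 𝒯 j i) : ContDiffOn ℝ (⊤ : ℕ∞) (fun f => C.len f i j) U :=
  (C.smooth i j hij).add (C.smooth j i hji)

theorem hasFDerivAt_len (C : Conformal2D V 𝒯 U) {i j : V} (hij : IsEdge 𝒯 i j)
    (hji : IsEdge 𝒯 j i) {f : V → ℝ} (hf : f ∈ U) :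
    HasFDerivAt (fun f => C.len f i j)
      (C.d f i j • ContinuousLinearMap.proj (R := ℝ) (φ := fun _ : V => ℝ) i
        + C.d f j i • ContinuousLinearMap.proj (R := ℝ) (φ := fun _ : V => ℝ) j) f := by
  have hd : HasFDerivAt (fun f => C.len f i j) (fderiv ℝ (fun f => C.len f i j) f) f :=
    (((C.contDiffOn_len hij hji).contDiffAt (C.openU.mem_nhds hf)).differentiableAt
      (by simp)).hasFDerivAt
  have hpart : ∀ m, HasDerivAt (fun s => C.len (Function.update f m s) i j)
      (fderiv ℝ (fun f => C.len f i j) f (Pi.single m 1)) (f m) := by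
    intro m
    have hd' : HasFDerivAt (fun f => C.len f i j) (fderiv ℝ (fun f => C.len f i j) f)
        (Function.update f m (f m)) := by rwa [Function.update_eq_self]
    exact hd'.comp_hasDerivAt (f m) (hasDerivAt_update f m (f m))
  refine hd.congr_fderiv ?_
  refine ContinuousLinearMap.coe_injective (LinearMap.pi_ext' fun m => LinearMap.ext_ring ?_)
  simp only [LinearMap.comp_apply, LinearMap.coe_single, ContinuousLinearMap.coe_coe]
  have hne := hij.1
  rcases eq_or_ne m i with rfl | hmi
  · rw [(hpart m).unique (C.derivLen m j hij f hf)]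
    simp [hne.symm]
  rcases eq_or_ne m j with rfl | hmj
  · have h := C.derivLen m i hji f hf
    simp only [add_comm (C.d _ m i)] at h
    rw [(hpart m).unique h]
    simp [hne]
  · have hc : (fun s => C.len (Function.update f m s) i j) = fun _ => C.len f i j := by
      funext s
      unfold len
      rw [C.localDep i j hij _ f (by simp [hmi.symm]) (by simp [hmj.symm]),
        C.localDep j i hji _ f (by simp [hmj.symm]) (by simp [hmi.symm])]
    have h := hpart m
    rw [hc] at h
    rw [h.unique (hasDerivAt_const _ _)]
    simp [hmi.symm, hmj.symm]

theorem IsTri.len_lt (C : Conformal2D V 𝒯 U) {i j k : V} (h : IsTri 𝒯 i j k) {f : V → ℝ}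
    (hf : f ∈ U) : C.len f i j < C.len f i k + C.len f j k :=
  C.triIneq f hf _ h.1 i (by simp) j (by simp) k (by simp) h.2.1 h.2.2.1 h.2.2.2

theorem contDiffOn_ang (C : Conformal2D V 𝒯 U) {i j k : V} (h : IsTri 𝒯 i j k) :
    ContDiffOn ℝ (⊤ : ℕ∞) (fun f => C.ang f i j k) U := by
  intro f hf
  have hU := C.openU.mem_nhds hf
  have h1 := h.len_lt C hf
  have h2 := h.swap_right.len_lt C hf
  have h3 := h.swap.swap_right.len_lt C hf
  rw [C.len_comm f k j] at h2
  rw [C.len_comm f j i, C.len_comm f k i] at h3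
  refine ContDiffAt.contDiffWithinAt (ContDiffAt.triAngle
    ((C.contDiffOn_len h.isEdge h.swap.isEdge).contDiffAt hU)
    ((C.contDiffOn_len h.swap_right.isEdge h.swap_right.swap.isEdge).contDiffAt hU)
    ((C.contDiffOn_len h.swap.swap_right.isEdge h.swap.swap_right.swap.isEdge).contDiffAt hU)
    (C.lenPos f hf _ _ h.isEdge) (C.lenPos f hf _ _ h.swap_right.isEdge)
    (C.lenPos f hf _ _ h.swap.swap_right.isEdge) h1 h2 (by linarith))

/-- The 1-form `γ_i df_i + γ_j df_j + γ_k df_k` of a triangle. -/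
noncomputable def angForm (C : Conformal2D V 𝒯 U) (i j k : V) (f : V → ℝ) : (V → ℝ) →L[ℝ] ℝ :=
  C.ang f i j k • ContinuousLinearMap.proj (R := ℝ) (φ := fun _ : V => ℝ) i
    + C.ang f j i k • ContinuousLinearMap.proj (R := ℝ) (φ := fun _ : V => ℝ) j
    + C.ang f k i j • ContinuousLinearMap.proj (R := ℝ) (φ := fun _ : V => ℝ) k

theorem contDiffOn_angForm (C : Conformal2D V 𝒯 U) {i j k : V} (h : IsTri 𝒯 i j k) :
    ContDiffOn ℝ (⊤ : ℕ∞) (C.angForm i j k) U :=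
  (((C.contDiffOn_ang h).smul contDiffOn_const).add
    ((C.contDiffOn_ang h.swap).smul contDiffOn_const)).add
    ((C.contDiffOn_ang (isTri_rotate.2 h)).smul contDiffOn_const)

/-- Equality of mixed partial derivatives of the angles, up to the area factor. -/
theorem ang_partial_symm {a b c p p' q q' r r' : ℝ} (ha : a ≠ 0) (hap : a = p + p')
    (hbq : b = q + q') (hcr : c = r + r')
    (hM : p ^ 2 + r ^ 2 + q' ^ 2 = p' ^ 2 + r' ^ 2 + q ^ 2) :
    2 * c * r - (a ^ 2 - b ^ 2 + c ^ 2) / a * p'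
      = 2 * b * q - (a ^ 2 + b ^ 2 - c ^ 2) / a * p := by
  field_simp
  subst hap hbq hcr
  linear_combination (p + p') * hM

theorem fderiv_angForm_symm (C : Conformal2D V 𝒯 U) {i j k : V} (h : IsTri 𝒯 i j k) {f : V → ℝ}
    (hf : f ∈ U) (v w : V → ℝ) :
    fderiv ℝ (C.angForm i j k) f v w = fderiv ℝ (C.angForm i j k) f w v := by
  have hij := h.isEdge
  have hik := h.swap_right.isEdge
  have hjk := h.swap.swap_right.isEdge
  have hji := h.swap.isEdge
  have hki := h.swap_right.swap.isEdge
  have hkj := h.swap.swap_right.swap.isEdge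
  have h1 := h.len_lt C hf
  have h2 := h.swap_right.len_lt C hf
  have h3 := h.swap.swap_right.len_lt C hf
  rw [C.len_comm f k j] at h2
  rw [C.len_comm f j i, C.len_comm f k i] at h3
  have ha : 0 < C.len f i j := C.lenPos f hf _ _ hij
  have hb : 0 < C.len f i k := C.lenPos f hf _ _ hik
  have hc : 0 < C.len f j k := C.lenPos f hf _ _ hjk
  have da := C.hasFDerivAt_len hij hji hf
  have db := C.hasFDerivAt_len hik hki hf
  have dc := C.hasFDerivAt_len hjk hkj hf
  have hM := C.metricCond f hf _ h.1 i (by simp) j (by simp) k (by simp) h.2.1 h.2.2.1 h.2.2.2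
  have gi := da.triAngle db dc ha hb hc h1 h2 (by linarith)
  have gj :=
    da.triAngle dc db ha hc hb (by linarith) (by linarith) (by linarith)
  have gk :=
    db.triAngle dc da hb hc ha (by linarith) (by linarith) (by linarith)
  have hform := ((gi.smul_const (ContinuousLinearMap.proj (R := ℝ) (φ := fun _ : V => ℝ) i)).fun_add
    (gj.smul_const (ContinuousLinearMap.proj (R := ℝ) (φ := fun _ : V => ℝ) j))).fun_add
    (gk.smul_const (ContinuousLinearMap.proj (R := ℝ) (φ := fun _ : V => ℝ) k))
  have hfun : C.angForm i j k = fun y =>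
      triAngle (C.len y i j) (C.len y i k) (C.len y j k) •
        ContinuousLinearMap.proj (R := ℝ) (φ := fun _ : V => ℝ) i
      + triAngle (C.len y i j) (C.len y j k) (C.len y i k) •
        ContinuousLinearMap.proj (R := ℝ) (φ := fun _ : V => ℝ) j
      + triAngle (C.len y i k) (C.len y j k) (C.len y i j) •
        ContinuousLinearMap.proj (R := ℝ) (φ := fun _ : V => ℝ) k := by
    funext y
    unfold angForm ang
    rw [C.len_comm y j i, C.len_comm y k i, C.len_comm y k j]
  rw [hfun, HasFDerivAt.fderiv hform]
  simp only [add_apply, ContinuousLinearMap.smulRight_apply,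
    smul_apply, sub_apply, ContinuousLinearMap.proj_apply,
    smul_eq_mul]
  have hD₁ : 2 * C.len f i j ^ 2 * C.len f j k ^ 2 + 2 * C.len f j k ^ 2 * C.len f i k ^ 2
      + 2 * C.len f i k ^ 2 * C.len f i j ^ 2 - C.len f i j ^ 4 - C.len f j k ^ 4 - C.len f i k ^ 4
      = 2 * C.len f i j ^ 2 * C.len f i k ^ 2 + 2 * C.len f i k ^ 2 * C.len f j k ^ 2
      + 2 * C.len f j k ^ 2 * C.len f i j ^ 2
      - C.len f i j ^ 4 - C.len f i k ^ 4 - C.len f j k ^ 4 := by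
    ring
  have hD₂ : 2 * C.len f i k ^ 2 * C.len f j k ^ 2 + 2 * C.len f j k ^ 2 * C.len f i j ^ 2
      + 2 * C.len f i j ^ 2 * C.len f i k ^ 2 - C.len f i k ^ 4 - C.len f j k ^ 4 - C.len f i j ^ 4
      = 2 * C.len f i j ^ 2 * C.len f i k ^ 2 + 2 * C.len f i k ^ 2 * C.len f j k ^ 2
      + 2 * C.len f j k ^ 2 * C.len f i j ^ 2
      - C.len f i j ^ 4 - C.len f i k ^ 4 - C.len f j k ^ 4 := by
    ring
  rw [hD₁, hD₂]
  generalize (√_)⁻¹ = D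
  have eij := ang_partial_symm ha.ne' (p := C.d f i j) (p' := C.d f j i) (q := C.d f i k)
    (q' := C.d f k i) (r := C.d f j k) (r' := C.d f k j) (b := C.len f i k) (c := C.len f j k)
    rfl rfl rfl (by linarith)
  have eik := ang_partial_symm hb.ne' (p := C.d f i k) (p' := C.d f k i) (q := C.d f i j)
    (q' := C.d f j i) (r := C.d f k j) (r' := C.d f j k) (b := C.len f i j) (c := C.len f j k)
    rfl rfl (add_comm _ _) (by linarith)
  have ejk := ang_partial_symm hc.ne' (p := C.d f j k) (p' := C.d f k j) (q := C.d f j i)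
    (q' := C.d f i j) (r := C.d f k i) (r' := C.d f i k) (b := C.len f i j) (c := C.len f i k)
    rfl (add_comm _ _) (add_comm _ _) (by linarith)
  linear_combination D * (v j * w i - v i * w j) * eij + D * (v k * w i - v i * w k) * eik
    + D * (v k * w j - v j * w k) * ejk

theorem exists_angForm_primitive (C : Conformal2D V 𝒯 U) [SimplyConnectedSpace U] (i j k : V) :
    ∃ G : (V → ℝ) → ℝ, IsTri 𝒯 i j k →
      ContDiffOn ℝ (⊤ : ℕ∞) G U ∧ ∀ f ∈ U, HasFDerivAt G (C.angForm i j k f) f := by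
  by_cases h : IsTri 𝒯 i j k
  · have hω := C.contDiffOn_angForm h
    obtain ⟨G, hG⟩ := exists_hasFDerivAt_of_fderiv_symmetric_of_simplyConnected C.openU
      (hω.differentiableOn (by simp)) fun f hf => C.fderiv_angForm_symm h hf
    refine ⟨G, fun _ => ⟨?_, hG⟩⟩
    rw [contDiffOn_infty_iff_fderiv_of_isOpen C.openU]
    exact ⟨fun f hf => (hG f hf).differentiableAt.differentiableWithinAt,
      hω.congr fun f hf => (hG f hf).fderiv⟩
  · exact ⟨0, fun h' => absurd h' h⟩

/-- Evaluating all triangle forms on the `m`-th coordinate direction counts every angle at `m`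
three times. -/
theorem sum_angForm_single (C : Conformal2D V 𝒯 U) (f : V → ℝ) (m : V) :
    ∑ i, ∑ j, ∑ k, (if IsTri 𝒯 i j k then C.angForm i j k f (Pi.single m 1) else 0)
      = 3 * ∑ j, ∑ k, if IsTri 𝒯 m j k then C.ang f m j k else 0 := by
  have hsplit : ∀ i j k, (if IsTri 𝒯 i j k then C.angForm i j k f (Pi.single m 1) else 0)
      = (if i = m then if IsTri 𝒯 i j k then C.ang f i j k else 0 else 0)
      + (if j = m then if IsTri 𝒯 j i k then C.ang f j i k else 0 else 0)
      + (if k = m then if IsTri 𝒯 k i j then C.ang f k i j else 0 else 0) := by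
    intro i j k
    simp only [isTri_swap (i := i) (j := j), isTri_rotate (i := i) (j := j) (k := k)]
    by_cases h : IsTri 𝒯 i j k
    · simp [h, angForm, Pi.single_apply]
    · simp [h]
  simp only [hsplit, Finset.sum_add_distrib]
  have e1 : ∑ i, ∑ j, ∑ k, (if i = m then if IsTri 𝒯 i j k then C.ang f i j k else 0 else 0)
      = ∑ j, ∑ k, if IsTri 𝒯 m j k then C.ang f m j k else 0 := by
    rw [Finset.sum_eq_single m (fun b _ hb => by simp [hb]) (by simp)]
    simp
  have e2 : ∑ i, ∑ j, ∑ k, (if j = m then if IsTri 𝒯 j i k then C.ang f j i k else 0 else 0)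
      = ∑ j, ∑ k, if IsTri 𝒯 m j k then C.ang f m j k else 0 := by
    refine Finset.sum_congr rfl fun i _ => ?_
    rw [Finset.sum_eq_single m (fun b _ hb => by simp [hb]) (by simp)]
    simp
  have e3 : ∑ i, ∑ j, ∑ k, (if k = m then if IsTri 𝒯 k i j then C.ang f k i j else 0 else 0)
      = ∑ j, ∑ k, if IsTri 𝒯 m j k then C.ang f m j k else 0 := by
    simp
  rw [e1, e2, e3]
  ring

end Conformal2D

open Conformal2D in
/-- For a conformal structure on an open, simply connected set `U ⊆ ℝ^V`,
there is a smooth function `F : U → ℝ` with `∂F/∂f_i = K_i` on `U` for every vertex. -/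
theorem curvature_is_variational_2d {V : Type*} [Fintype V] [DecidableEq V]
    {𝒯 : Finset (Finset V)} {U : Set (V → ℝ)} (C : Conformal2D V 𝒯 U)
    (hsc : SimplyConnectedSpace U) :
    ∃ F : (V → ℝ) → ℝ, ContDiffOn ℝ (⊤ : ℕ∞) F U ∧
      ∀ f ∈ U, ∀ i : V,
        HasDerivAt (fun s : ℝ => F (Function.update f i s)) (C.K f i) (f i) := by
  choose G hG using fun i j k => C.exists_angForm_primitive i j k
  refine ⟨fun f => 2 * Real.pi * ∑ i, f i
    - (1 / 6) * ∑ i, ∑ j, ∑ k, if IsTri 𝒯 i j k then G i j k f else 0, ?_, ?_⟩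
  · refine ContDiffOn.sub (by fun_prop) (contDiffOn_const.mul ?_)
    refine ContDiffOn.sum fun i _ => ContDiffOn.sum fun j _ => ContDiffOn.sum fun k _ => ?_
    split_ifs with h
    · exact (hG i j k h).1
    · exact contDiffOn_const
  · intro f hf m
    have hterm : ∀ i j k, HasDerivAt
        (fun s => if IsTri 𝒯 i j k then G i j k (Function.update f m s) else 0)
        (if IsTri 𝒯 i j k then C.angForm i j k f (Pi.single m 1) else 0) (f m) := by
      intro i j k
      split_ifs with h
      · have hd : HasFDerivAt (G i j k) (C.angForm i j k f) (Function.update f m (f m)) := by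
          rw [Function.update_eq_self]
          exact (hG i j k h).2 f hf
        exact hd.comp_hasDerivAt (f m) (hasDerivAt_update f m (f m))
      · exact hasDerivAt_const _ _
    have hlin : HasDerivAt (fun s => ∑ i, Function.update f m s i) 1 (f m) := by
      have := HasDerivAt.fun_sum (u := Finset.univ)
        fun i _ => hasDerivAt_pi.1 (hasDerivAt_update f m (f m)) i
      simpa using this
    have hsum := HasDerivAt.fun_sum (u := Finset.univ) fun i _ =>
      HasDerivAt.fun_sum (u := Finset.univ) fun j _ =>
        HasDerivAt.fun_sum (u := Finset.univ) fun k _ => hterm i j k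
    refine ((hlin.const_mul (2 * Real.pi)).sub (hsum.const_mul (1 / 6))).congr_deriv ?_
    rw [C.sum_angForm_single]
    unfold K IsTri
    ring_nf
end

section
/- Let V be a finite vertex set, 𝒯 a finite collection of 3-element subsets of V, and fix η_ij ≥ 0 for each edge {i,j}. Consider the fixed inversive distance conformal structure defined on the open set U ⊆ ℝ^V where every triangle of 𝒯 satisfies the strict triangle inequality: ℓ_ij(f) = sqrt(e^{2f_i} + e^{2f_j} + 2 e^{f_i + f_j} η_ij) and d_ij(f) = e^{f_i}(e^{f_i} + e^{f_j} η_ij)/ℓ_ij(f). Then for every f ∈ U and every x ∈ ℝ^V, Σ_{edges {i,j}} (ℓ*_ij/ℓ_ij)(x_j − x_i)² ≥ 0; consequently any smooth F : U → ℝ with ∂F/∂f_i = K_i for all i is convex along every line segment contained in U. -/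
open Finset

namespace InversiveDistance

variable {V : Type*} [Fintype V] [DecidableEq V]

/-- The length `ℓ_ij(f) = sqrt(e^{2f_i} + e^{2f_j} + 2 e^{f_i+f_j} η_ij)` of the fixed
inversive distance conformal structure. -/
noncomputable def len (η : V → V → ℝ) (f : V → ℝ) (i j : V) : ℝ :=
  Real.sqrt (Real.exp (2 * f i) + Real.exp (2 * f j)
    + 2 * Real.exp (f i + f j) * η i j)

/-- `d_ij(f) = e^{f_i}(e^{f_i} + e^{f_j} η_ij)/ℓ_ij(f)`. -/
noncomputable def dd (η : V → V → ℝ) (f : V → ℝ) (i j : V) : ℝ :=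
  Real.exp (f i) * (Real.exp (f i) + Real.exp (f j) * η i j) / len η f i j

/-- The angle `γ_{i,jk}` at vertex `i` in the triangle `{i, j, k}`. -/
noncomputable def ang (η : V → V → ℝ) (f : V → ℝ) (i j k : V) : ℝ :=
  triAngle (len η f i j) (len η f i k) (len η f j k)

/-- `h_{ij,k} = (d_ik − d_ij cos γ_{i,jk}) / sin γ_{i,jk}`. -/
noncomputable def hh (η : V → V → ℝ) (f : V → ℝ) (i j k : V) : ℝ :=
  (dd η f i k - dd η f i j * Real.cos (ang η f i j k)) / Real.sin (ang η f i j k)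

/-- The curvature `K_i = 2π − Σ_{{i,j,k} ∈ 𝒯} γ_{i,jk}` (ordered double sum halved). -/
noncomputable def K (𝒯 : Finset (Finset V)) (η : V → V → ℝ) (f : V → ℝ) (i : V) : ℝ :=
  2 * Real.pi - (1 / 2) * ∑ j : V, ∑ k : V,
    if ({i, j, k} : Finset V) ∈ 𝒯 ∧ i ≠ j ∧ i ≠ k ∧ j ≠ k then ang η f i j k else 0

/-- The dual length `ℓ*_ij = Σ_{{i,j,k} ∈ 𝒯} h_{ij,k}`. -/
noncomputable def dualLen (𝒯 : Finset (Finset V)) (η : V → V → ℝ) (f : V → ℝ)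
    (i j : V) : ℝ :=
  ∑ k : V,
    if ({i, j, k} : Finset V) ∈ 𝒯 ∧ i ≠ j ∧ i ≠ k ∧ j ≠ k then hh η f i j k else 0

/-- The domain `U`: all `f` for which every triangle of `𝒯` satisfies the strict
triangle inequality. -/
def Uset (𝒯 : Finset (Finset V)) (η : V → V → ℝ) : Set (V → ℝ) :=
  {f | ∀ T ∈ 𝒯, ∀ i ∈ T, ∀ j ∈ T, ∀ k ∈ T, i ≠ j → i ≠ k → j ≠ k →
    len η f i j < len η f i k + len η f j k}

end InversiveDistance

namespace InversiveDistance

/-- The squared length `x² + y² + 2xya` of an edge with end radii `x`, `y` and inversive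
distance `a`. -/
def sqLen (x y a : ℝ) : ℝ := x ^ 2 + y ^ 2 + 2 * x * y * a

/-- The dot product of the two sides at the vertex of radius `x` of the triangle with radii
`x`, `y`, `z` and inversive distances `a = η_xy`, `b = η_xz`, `c = η_yz`. -/
noncomputable def sideDot (x y z a b c : ℝ) : ℝ :=
  (sqLen x y a + sqLen x z b - sqLen y z c) / 2

/-- Four times the squared area of the triangle. -/
noncomputable def areaSq (x y z a b c : ℝ) : ℝ :=
  sqLen x y a * sqLen x z b - sideDot x y z a b c ^ 2

/-- The numerator of the weight of the edge `xy` in the triangle, up to the factor `xy`. -/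
def cofac (x y z a b c : ℝ) : ℝ :=
  x * y * (1 - a ^ 2) + y * z * (b + a * c) + x * z * (c + a * b)

/-- The weight `h_{xy,z} / ℓ_xy` of the edge `xy` in the triangle. -/
noncomputable def weight (x y z a b c : ℝ) : ℝ :=
  x * y * cofac x y z a b c / (√(areaSq x y z a b c) * sqLen x y a)

lemma sqLen_comm (x y a : ℝ) : sqLen x y a = sqLen y x a := by
  unfold sqLen; ring

lemma sqLen_pos {x y a : ℝ} (hx : 0 < x) (hy : 0 < y) (ha : 0 ≤ a) : 0 < sqLen x y a := by
  unfold sqLen; positivity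

lemma areaSq_swap_left (x y z a b c : ℝ) : areaSq y x z a c b = areaSq x y z a b c := by
  unfold areaSq sideDot sqLen; ring

lemma areaSq_swap_right (x y z a b c : ℝ) : areaSq x z y b a c = areaSq x y z a b c := by
  unfold areaSq sideDot sqLen; ring

lemma weight_swap_left (x y z a b c : ℝ) : weight y x z a c b = weight x y z a b c := by
  unfold weight
  rw [areaSq_swap_left, sqLen_comm y x]
  congr 1
  unfold cofac
  ring

/-- Of the three cofactors of a triangle, no two are negative. -/
lemma not_two_cofac_neg {x y z a b c : ℝ} (hx : 0 < x) (hy : 0 < y) (hz : 0 < z)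
    (ha : 0 ≤ a) (hb : 0 ≤ b) (hc : 0 ≤ c) (h1 : cofac y z x c a b < 0) :
    0 ≤ cofac x z y b a c := by
  by_contra! h2
  unfold cofac at h1 h2
  have e1 : x * (a + b * c) < y * (c ^ 2 - 1) := by
    have : 0 ≤ x * y * (b + a * c) := by positivity
    refine lt_of_mul_lt_mul_left (a := z) ?_ hz.le
    nlinarith
  have e2 : y * (a + b * c) < x * (b ^ 2 - 1) := by
    have : 0 ≤ x * y * (c + a * b) := by positivity
    refine lt_of_mul_lt_mul_left (a := z) ?_ hz.le
    nlinarith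
  have hG : 0 ≤ a + b * c := by positivity
  have e3 := mul_lt_mul'' e1 e2 (by positivity) (by positivity)
  have e4 : (a + b * c) ^ 2 < (c ^ 2 - 1) * (b ^ 2 - 1) := by
    refine lt_of_mul_lt_mul_left (a := x * y) ?_ (by positivity)
    nlinarith
  have e5 : 0 < c ^ 2 - 1 := by
    refine pos_of_mul_pos_right (a := y) (lt_of_le_of_lt (by positivity) e1) hy.le
  have : 0 ≤ a * b * c := by positivity
  nlinarith [sq_nonneg a, sq_nonneg b]

lemma areaSq_eq_sum_cofac (x y z a b c : ℝ) :
    areaSq x y z a b c =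
      x * y * cofac x y z a b c + x * z * cofac x z y b a c + y * z * cofac y z x c a b := by
  unfold areaSq sideDot sqLen cofac; ring

lemma cofac_products_nonneg {x y z a b c : ℝ} (hx : 0 < x) (hy : 0 < y) (hz : 0 < z)
    (ha : 0 ≤ a) (hb : 0 ≤ b) (hc : 0 ≤ c) (hT : 0 < areaSq x y z a b c) :
    0 ≤ (x * y * cofac x y z a b c) * (x * z * cofac x z y b a c) * sqLen y z c
      + (x * y * cofac x y z a b c) * (y * z * cofac y z x c a b) * sqLen x z b
      + (x * z * cofac x z y b a c) * (y * z * cofac y z x c a b) * sqLen x y a := by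
  have key : (x * y * cofac x y z a b c) * (x * z * cofac x z y b a c) * sqLen y z c
      + (x * y * cofac x y z a b c) * (y * z * cofac y z x c a b) * sqLen x z b
      + (x * z * cofac x z y b a c) * (y * z * cofac y z x c a b) * sqLen x y a
      = areaSq x y z a b c * (x * y * z * (x * x * y * (a * c + b) + x * x * z * (a + b * c)
        + x * y * y * (a * b + c) + 2 * x * y * z * (a * b * c + 1) + x * z * z * (a * b + c)
        + y * y * z * (a + b * c) + y * z * z * (a * c + b))) := by
    unfold areaSq sideDot sqLen cofac; ring
  rw [key]
  positivity

lemma laplacian_nonneg_of_add_pos {u v w : ℝ} (huv : 0 < u + v)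
    (h : 0 ≤ u * v + u * w + v * w) (p q r : ℝ) :
    0 ≤ u * (q - p) ^ 2 + v * (r - p) ^ 2 + w * (r - q) ^ 2 := by
  refine (mul_nonneg_iff_of_pos_left huv).mp ?_
  have : (u + v) * (u * (q - p) ^ 2 + v * (r - p) ^ 2 + w * (r - q) ^ 2)
      = ((u + v) * p - u * q - v * r) ^ 2 + (u * v + u * w + v * w) * (r - q) ^ 2 := by ring
  rw [this]
  positivity

/-- A weighted triangle Laplacian is nonnegative if no two of its weights `A/L`, `B/M`, `C/N`
are negative, `A + B + C > 0`, and its principal minor is nonnegative. -/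
lemma laplacian_nonneg {A B C L M N : ℝ} (hL : 0 < L) (hM : 0 < M) (hN : 0 < N)
    (hsum : 0 < A + B + C) (hAB : A < 0 → 0 ≤ B) (hAC : A < 0 → 0 ≤ C) (hBC : B < 0 → 0 ≤ C)
    (h : 0 ≤ A * B * N + A * C * M + B * C * L) (p q r : ℝ) :
    0 ≤ A / L * (q - p) ^ 2 + B / M * (r - p) ^ 2 + C / N * (r - q) ^ 2 := by
  have h' : 0 ≤ A / L * (B / M) + A / L * (C / N) + B / M * (C / N) := by
    have : A / L * (B / M) + A / L * (C / N) + B / M * (C / N)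
        = (A * B * N + A * C * M + B * C * L) / (L * M * N) := by field_simp
    rw [this]
    positivity
  have hpos : ∀ {X Y S R : ℝ}, 0 < S → 0 < R → 0 ≤ X → 0 ≤ Y → 0 < X + Y → 0 < X / S + Y / R := by
    intro X Y S R hS hR hX hY hXY
    rcases hX.eq_or_lt with rfl | hX
    · have : 0 < Y := by linarith
      positivity
    · positivity
  have hcases : (0 ≤ A ∧ 0 ≤ B ∧ 0 < A + B) ∨ (0 ≤ A ∧ 0 ≤ C ∧ 0 < A + C)
      ∨ (0 ≤ B ∧ 0 ≤ C ∧ 0 < B + C) := by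
    grind
  rcases hcases with ⟨h1, h2, h3⟩ | ⟨h1, h2, h3⟩ | ⟨h1, h2, h3⟩
  · exact laplacian_nonneg_of_add_pos (hpos hL hM h1 h2 h3) h' p q r
  · have := laplacian_nonneg_of_add_pos (w := B / M) (hpos hL hN h1 h2 h3) (by linarith) q p r
    linarith
  · have := laplacian_nonneg_of_add_pos (w := A / L) (hpos hM hN h1 h2 h3) (by linarith) r p q
    linarith

/-- The quadratic form of a single triangle is nonnegative. -/
lemma triangle_form_nonneg {x y z a b c : ℝ} (hx : 0 < x) (hy : 0 < y) (hz : 0 < z)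
    (ha : 0 ≤ a) (hb : 0 ≤ b) (hc : 0 ≤ c) (hT : 0 < areaSq x y z a b c) (p q r : ℝ) :
    0 ≤ weight x y z a b c * (q - p) ^ 2 + weight x z y b a c * (r - p) ^ 2
      + weight y z x c a b * (r - q) ^ 2 := by
  have e1 : areaSq x z y b a c = areaSq x y z a b c := areaSq_swap_right ..
  have e2 : areaSq y z x c a b = areaSq x y z a b c := by
    unfold areaSq sideDot sqLen; ring
  have hp : ∀ {s t P : ℝ}, 0 < s → 0 < t → 0 ≤ P → 0 ≤ s * t * P := by
    intros; positivity
  have hn : ∀ {s t P : ℝ}, 0 < s → 0 < t → s * t * P < 0 → P < 0 := by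
    intro s t P hs ht h
    by_contra! h'
    exact absurd (hp hs ht h') (not_le.mpr h)
  have h := laplacian_nonneg (sqLen_pos hx hy ha) (sqLen_pos hx hz hb) (sqLen_pos hy hz hc)
    (areaSq_eq_sum_cofac x y z a b c ▸ hT)
    (fun h => hp hx hz ?_) (fun h => hp hy hz ?_) (fun h => hp hy hz ?_)
    (cofac_products_nonneg hx hy hz ha hb hc hT) p q r
  · have := div_nonneg h (Real.sqrt_nonneg (areaSq x y z a b c))
    unfold weight
    rw [e1, e2]
    exact this.trans_eq (by ring)
  · have h' := hn hx hy h
    have := not_two_cofac_neg (x := y) (y := x) (z := z) hy hx hz ha hc hb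
    by_contra! h''
    have := not_two_cofac_neg hz hy hx hc hb ha (by unfold cofac at *; linarith)
    unfold cofac at *
    linarith
  · have h' := hn hx hy h
    by_contra! h''
    have := not_two_cofac_neg hz hx hy hb hc ha (by unfold cofac at *; linarith)
    unfold cofac at *
    linarith
  · by_contra! h'
    have := not_two_cofac_neg hx hy hz ha hb hc h'
    linarith [hn hx hz h]

lemma one_sub_sideDot_div_sq {x y z a b c : ℝ} (hx : 0 < x) (hy : 0 < y) (hz : 0 < z)
    (ha : 0 ≤ a) (hb : 0 ≤ b) :
    √(1 - (sideDot x y z a b c / √(sqLen x y a * sqLen x z b)) ^ 2)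
      = √(areaSq x y z a b c) / √(sqLen x y a * sqLen x z b) := by
  have h1 := sqLen_pos hx hy ha
  have h2 := sqLen_pos hx hz hb
  rw [← Real.sqrt_div' _ (by positivity), div_pow, Real.sq_sqrt (by positivity)]
  congr 1
  unfold areaSq
  field_simp

lemma triAngle_sqrt {x y z a b c : ℝ} (hx : 0 < x) (hy : 0 < y) (hz : 0 < z)
    (ha : 0 ≤ a) (hb : 0 ≤ b) (hc : 0 ≤ c) :
    triAngle √(sqLen x y a) √(sqLen x z b) √(sqLen y z c)
      = Real.arccos (sideDot x y z a b c / √(sqLen x y a * sqLen x z b)) := by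
  have h1 := sqLen_pos hx hy ha
  have h2 := sqLen_pos hx hz hb
  have h3 := sqLen_pos hy hz hc
  rw [triAngle, Real.sq_sqrt h1.le, Real.sq_sqrt h2.le, Real.sq_sqrt h3.le,
    Real.sqrt_mul h1.le, sideDot, div_div, mul_assoc]

lemma sideDot_div_sq_lt_one {x y z a b c : ℝ} (hx : 0 < x) (hy : 0 < y) (hz : 0 < z)
    (ha : 0 ≤ a) (hb : 0 ≤ b) (hT : 0 < areaSq x y z a b c) :
    (sideDot x y z a b c / √(sqLen x y a * sqLen x z b)) ^ 2 < 1 := by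
  have h1 := sqLen_pos hx hy ha
  have h2 := sqLen_pos hx hz hb
  rw [div_pow, Real.sq_sqrt (by positivity), div_lt_one (by positivity)]
  unfold areaSq at hT
  linarith

/-- The distance from the power center to an edge, divided by the length of the edge. -/
lemma height_div_len {x y z a b c : ℝ} (hx : 0 < x) (hy : 0 < y) (hz : 0 < z)
    (ha : 0 ≤ a) (hb : 0 ≤ b) (hc : 0 ≤ c) (hT : 0 < areaSq x y z a b c) :
    (x * (x + z * b) / √(sqLen x z b) - x * (x + y * a) / √(sqLen x y a)
        * Real.cos (triAngle √(sqLen x y a) √(sqLen x z b) √(sqLen y z c)))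
      / Real.sin (triAngle √(sqLen x y a) √(sqLen x z b) √(sqLen y z c)) / √(sqLen x y a)
      = weight x y z a b c := by
  have h1 := sqLen_pos hx hy ha
  have h2 := sqLen_pos hx hz hb
  have hq := abs_lt.mp ((sq_lt_one_iff_abs_lt_one _).mp
    (sideDot_div_sq_lt_one hx hy hz ha hb hT))
  rw [triAngle_sqrt hx hy hz ha hb hc, Real.sin_arccos, Real.cos_arccos hq.1.le hq.2.le,
    one_sub_sideDot_div_sq hx hy hz ha hb, Real.sqrt_mul h1.le, weight]
  have e1 := Real.sq_sqrt h1.le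
  have s1 := Real.sqrt_pos.mpr h1
  have s2 := Real.sqrt_pos.mpr h2
  have s3 := Real.sqrt_pos.mpr hT
  have num : x * y * cofac x y z a b c
      = x * (x + z * b) * sqLen x y a - x * (x + y * a) * sideDot x y z a b c := by
    unfold cofac sideDot sqLen; ring
  rw [num]
  generalize hS : √(sqLen x y a) = S at *
  rw [← e1]
  field_simp

lemma hasDerivAt_sqLen {x y : ℝ → ℝ} {a u v t : ℝ} (hx : HasDerivAt x (u * x t) t)
    (hy : HasDerivAt y (v * y t) t) :
    HasDerivAt (fun s => sqLen (x s) (y s) a)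
      (2 * (u * (x t * (x t + y t * a)) + v * (y t * (y t + x t * a)))) t := by
  have := ((hx.pow 2).add (hy.pow 2)).add (((hx.const_mul 2).mul hy).mul_const a)
  refine this.congr_deriv ?_
  simp only [Nat.cast_ofNat, Nat.add_one_sub_one, pow_one]
  ring

lemma angle_variation_identity {A S p q p' q' e e' u v w : ℝ} (hA : A ≠ 0) (hS : S ≠ 0)
    (h1 : p + q ≠ 0) (h2 : p' + q' ≠ 0) (hS2 : S ^ 2 = (p + q) * (p' + q')) :
    -(1 / (A / S)) * (((2 * (u * p + v * q) + 2 * (u * p' + w * q') - 2 * (v * e + w * e')) / 2 * S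
        - (p + q + (p' + q') - (e + e')) / 2 * ((2 * (u * p + v * q) * (p' + q')
          + (p + q) * (2 * (u * p' + w * q'))) / (2 * S))) / S ^ 2)
      = (q * ((p + q + (p' + q') - (e + e')) / 2) - (q - e) * (p + q)) / (A * (p + q)) * (v - u)
        + (q' * ((p + q + (p' + q') - (e + e')) / 2) - (q' - e') * (p' + q'))
          / (A * (p' + q')) * (w - u) := by
  have key : ∀ N D M : ℝ, -(1 / (A / S)) * ((N / 2 * S - D * (M / (2 * S))) / S ^ 2)
      = -(N / 2 - D * M / (2 * S ^ 2)) / A := by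
    intros; field_simp
  rw [key, hS2]
  field_simp
  ring

/-- The variation of an angle under a conformal variation of the radii. -/
lemma hasDerivAt_triAngle {x y z : ℝ → ℝ} {a b c u v w t : ℝ}
    (hx : HasDerivAt x (u * x t) t) (hy : HasDerivAt y (v * y t) t)
    (hz : HasDerivAt z (w * z t) t) (hx0 : ∀ s, 0 < x s) (hy0 : ∀ s, 0 < y s)
    (hz0 : ∀ s, 0 < z s) (ha : 0 ≤ a) (hb : 0 ≤ b) (hc : 0 ≤ c)
    (hT : 0 < areaSq (x t) (y t) (z t) a b c) :
    HasDerivAt (fun s => triAngle √(sqLen (x s) (y s) a) √(sqLen (x s) (z s) b)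
        √(sqLen (y s) (z s) c))
      (weight (x t) (y t) (z t) a b c * (v - u) + weight (x t) (z t) (y t) b a c * (w - u)) t := by
  have hfun : (fun s => triAngle √(sqLen (x s) (y s) a) √(sqLen (x s) (z s) b)
      √(sqLen (y s) (z s) c)) = fun s => Real.arccos (sideDot (x s) (y s) (z s) a b c /
        √(sqLen (x s) (y s) a * sqLen (x s) (z s) b)) :=
    funext fun s => triAngle_sqrt (hx0 s) (hy0 s) (hz0 s) ha hb hc
  rw [hfun]
  have h1 := sqLen_pos (hx0 t) (hy0 t) ha
  have h2 := sqLen_pos (hx0 t) (hz0 t) hb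
  have hq := abs_lt.mp ((sq_lt_one_iff_abs_lt_one _).mp
    (sideDot_div_sq_lt_one (hx0 t) (hy0 t) (hz0 t) ha hb hT))
  have d1 := hasDerivAt_sqLen (a := a) hx hy
  have d2 := hasDerivAt_sqLen (a := b) hx hz
  have d3 := hasDerivAt_sqLen (a := c) hy hz
  have dD : HasDerivAt (fun s => sideDot (x s) (y s) (z s) a b c) _ t :=
    ((d1.add d2).sub d3).div_const 2
  have hM : 0 < sqLen (x t) (y t) a * sqLen (x t) (z t) b := by positivity
  have sM := Real.sqrt_pos.mpr hM
  have dq := dD.div ((d1.mul d2).sqrt hM.ne') sM.ne'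
  have := (Real.hasDerivAt_arccos hq.1.ne' hq.2.ne).comp t dq
  refine this.congr_deriv ?_
  simp only [Pi.mul_apply]
  rw [one_sub_sideDot_div_sq (hx0 t) (hy0 t) (hz0 t) ha hb]
  simp only [weight]
  rw [areaSq_swap_right (x t) (y t) (z t)]
  have s3 := Real.sqrt_pos.mpr hT
  have e1 := Real.sq_sqrt hM.le
  generalize √(areaSq (x t) (y t) (z t) a b c) = A at *
  generalize √(sqLen (x t) (y t) a * sqLen (x t) (z t) b) = S at *
  generalize x t = X at *
  generalize y t = Y at *
  generalize z t = Z at *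
  have num1 : X * Y * cofac X Y Z a b c = Y * (Y + X * a) * sideDot X Y Z a b c
      - (Y * (Y + X * a) - Y * (Y + Z * c)) * sqLen X Y a := by
    unfold cofac sideDot sqLen; ring
  have num2 : X * Z * cofac X Z Y b a c = Z * (Z + X * b) * sideDot X Y Z a b c
      - (Z * (Z + X * b) - Z * (Z + Y * c)) * sqLen X Z b := by
    unfold cofac sideDot sqLen; ring
  have hD : sideDot X Y Z a b c = (X * (X + Y * a) + Y * (Y + X * a) + (X * (X + Z * b)
      + Z * (Z + X * b)) - (Y * (Y + Z * c) + Z * (Z + Y * c))) / 2 := by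
    unfold sideDot sqLen; ring
  have hL : sqLen X Y a = X * (X + Y * a) + Y * (Y + X * a) := by
    unfold sqLen; ring
  have hM' : sqLen X Z b = X * (X + Z * b) + Z * (Z + X * b) := by
    unfold sqLen; ring
  rw [num1, num2, hD, hL, hM']
  rw [hL] at h1 e1
  rw [hM'] at h2 e1
  generalize X * (X + Y * a) = p at *
  generalize Y * (Y + X * a) = q at *
  generalize X * (X + Z * b) = p' at *
  generalize Z * (Z + X * b) = q' at *
  generalize Y * (Y + Z * c) = e at *
  generalize Z * (Z + Y * c) = e' at *
  exact angle_variation_identity s3.ne' sM.ne' h1.ne' h2.ne' e1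

lemma areaSq_pos {x y z a b c : ℝ} (hx : 0 < x) (hy : 0 < y) (hz : 0 < z)
    (ha : 0 ≤ a) (hb : 0 ≤ b) (hc : 0 ≤ c)
    (h1 : √(sqLen x y a) < √(sqLen x z b) + √(sqLen y z c))
    (h2 : √(sqLen x z b) < √(sqLen x y a) + √(sqLen y z c))
    (h3 : √(sqLen y z c) < √(sqLen x y a) + √(sqLen x z b)) : 0 < areaSq x y z a b c := by
  have e1 := Real.sq_sqrt (sqLen_pos hx hy ha).le
  have e2 := Real.sq_sqrt (sqLen_pos hx hz hb).le
  have e3 := Real.sq_sqrt (sqLen_pos hy hz hc).le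
  have s1 := Real.sqrt_nonneg (sqLen x y a)
  have s2 := Real.sqrt_nonneg (sqLen x z b)
  have s3 := Real.sqrt_nonneg (sqLen y z c)
  unfold areaSq sideDot
  rw [← e1, ← e2, ← e3]
  generalize √(sqLen x y a) = p at *
  generalize √(sqLen x z b) = q at *
  generalize √(sqLen y z c) = r at *
  have heron : p ^ 2 * q ^ 2 - ((p ^ 2 + q ^ 2 - r ^ 2) / 2) ^ 2
      = (q + r - p) * (p + r - q) * (p + q - r) * (p + q + r) / 4 := by ring
  rw [heron]
  have := sub_pos.mpr h1
  have := sub_pos.mpr h2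
  have := sub_pos.mpr h3
  have : 0 < p + q + r := by linarith
  positivity

lemma len_eq {V : Type*} (η : V → V → ℝ) (f : V → ℝ) (i j : V) :
    len η f i j = √(sqLen (Real.exp (f i)) (Real.exp (f j)) (η i j)) := by
  unfold len sqLen
  rw [Real.exp_add, two_mul, two_mul, Real.exp_add, Real.exp_add]
  congr 1
  ring

section Sums

variable {V : Type*} [Fintype V] (G : V → V → V → ℝ)

lemma sum_swap_right : ∑ i, ∑ j, ∑ k, G i k j = ∑ i, ∑ j, ∑ k, G i j k :=
  Finset.sum_congr rfl fun _ _ => Finset.sum_comm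

lemma sum_swap_left : ∑ i, ∑ j, ∑ k, G j i k = ∑ i, ∑ j, ∑ k, G i j k :=
  Finset.sum_comm

lemma sum_rotate : ∑ i, ∑ j, ∑ k, G j k i = ∑ i, ∑ j, ∑ k, G i j k := by
  exact (sum_swap_left fun i j k => G i k j).trans (sum_swap_right G)

end Sums

variable {V : Type*} [DecidableEq V]

/-- `{i, j, k}` is a triangle of `𝒯` with distinct vertices `i`, `j`, `k`. -/
abbrev IsTriangle (𝒯 : Finset (Finset V)) (i j k : V) : Prop :=
  ({i, j, k} : Finset V) ∈ 𝒯 ∧ i ≠ j ∧ i ≠ k ∧ j ≠ k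

lemma isTriangle_swap_left (𝒯 : Finset (Finset V)) (i j k : V) :
    IsTriangle 𝒯 j i k ↔ IsTriangle 𝒯 i j k := by
  have : ({j, i, k} : Finset V) = {i, j, k} := Finset.insert_comm ..
  grind

lemma isTriangle_swap_right (𝒯 : Finset (Finset V)) (i j k : V) :
    IsTriangle 𝒯 i k j ↔ IsTriangle 𝒯 i j k := by
  have : ({i, k, j} : Finset V) = {i, j, k} := by rw [Finset.pair_comm]
  grind

/-- The weight `h_{ij,k} / ℓ_ij`. -/
noncomputable def triWeight (η : V → V → ℝ) (f : V → ℝ) (i j k : V) : ℝ :=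
  weight (Real.exp (f i)) (Real.exp (f j)) (Real.exp (f k)) (η i j) (η i k) (η j k)

/-- The contribution of the edge `{i, j}` of the triangle `{i, j, k}` to the quadratic form. -/
noncomputable def edgeTerm (𝒯 : Finset (Finset V)) (η : V → V → ℝ) (f x : V → ℝ)
    (i j k : V) : ℝ :=
  if IsTriangle 𝒯 i j k then triWeight η f i j k * (x j - x i) ^ 2 else 0

lemma IsTriangle.isEdge {𝒯 : Finset (Finset V)} {i j k : V} (h : IsTriangle 𝒯 i j k) :
    IsEdge 𝒯 i j :=
  ⟨h.2.1, _, h.1, by simp, by simp⟩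


lemma IsTriangle.eta_nonneg {𝒯 : Finset (Finset V)} {η : V → V → ℝ}
    (hnn : ∀ i j : V, IsEdge 𝒯 i j → 0 ≤ η i j) {i j k : V} (h : IsTriangle 𝒯 i j k) :
    0 ≤ η i j ∧ 0 ≤ η i k ∧ 0 ≤ η j k :=
  ⟨hnn _ _ h.isEdge, hnn _ _ ((isTriangle_swap_right ..).mpr h).isEdge,
    hnn _ _ ((isTriangle_swap_right ..).mpr ((isTriangle_swap_left ..).mpr h)).isEdge⟩

lemma len_comm {V : Type*} {η : V → V → ℝ} (hsymm : ∀ i j : V, η i j = η j i) (f : V → ℝ)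
    (i j : V) : len η f i j = len η f j i := by
  rw [len_eq, len_eq, sqLen_comm, hsymm]

lemma triWeight_swap_left {V : Type*} {η : V → V → ℝ} (hsymm : ∀ i j : V, η i j = η j i)
    (f : V → ℝ) (i j k : V) : triWeight η f j i k = triWeight η f i j k := by
  unfold triWeight
  rw [hsymm j i, weight_swap_left]

lemma IsTriangle.areaSq_pos {𝒯 : Finset (Finset V)} {η : V → V → ℝ}
    (hsymm : ∀ i j : V, η i j = η j i) (hnn : ∀ i j : V, IsEdge 𝒯 i j → 0 ≤ η i j)
    {f : V → ℝ} (hf : f ∈ Uset 𝒯 η) {i j k : V} (h : IsTriangle 𝒯 i j k) :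
    0 < areaSq (Real.exp (f i)) (Real.exp (f j)) (Real.exp (f k)) (η i j) (η i k) (η j k) := by
  obtain ⟨ha, hb, hc⟩ := h.eta_nonneg hnn
  obtain ⟨hT, hij, hik, hjk⟩ := h
  have hi : i ∈ ({i, j, k} : Finset V) := by simp
  have hj : j ∈ ({i, j, k} : Finset V) := by simp
  have hk : k ∈ ({i, j, k} : Finset V) := by simp
  have h1 := hf _ hT i hi j hj k hk hij hik hjk
  have h2 := hf _ hT i hi k hk j hj hik hij hjk.symm
  have h3 := hf _ hT j hj k hk i hi hjk hij.symm hik.symm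
  rw [len_comm hsymm f k j] at h2
  rw [len_comm hsymm f j i, len_comm hsymm f k i] at h3
  simp only [len_eq] at h1 h2 h3
  exact InversiveDistance.areaSq_pos (Real.exp_pos _) (Real.exp_pos _) (Real.exp_pos _)
    ha hb hc h1 h2 h3

lemma hh_div_len {𝒯 : Finset (Finset V)} {η : V → V → ℝ}
    (hsymm : ∀ i j : V, η i j = η j i) (hnn : ∀ i j : V, IsEdge 𝒯 i j → 0 ≤ η i j)
    {f : V → ℝ} (hf : f ∈ Uset 𝒯 η) {i j k : V} (h : IsTriangle 𝒯 i j k) :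
    hh η f i j k / len η f i j = triWeight η f i j k := by
  obtain ⟨ha, hb, hc⟩ := h.eta_nonneg hnn
  unfold hh ang dd triWeight
  simp only [len_eq]
  exact height_div_len (Real.exp_pos _) (Real.exp_pos _) (Real.exp_pos _) ha hb hc
    (h.areaSq_pos hsymm hnn hf)

/-- The quadratic form as a sum over ordered triangles. -/
lemma edge_sum_eq [Fintype V] {𝒯 : Finset (Finset V)} {η : V → V → ℝ}
    (hsymm : ∀ i j : V, η i j = η j i) (hnn : ∀ i j : V, IsEdge 𝒯 i j → 0 ≤ η i j)
    {f : V → ℝ} (hf : f ∈ Uset 𝒯 η) (x : V → ℝ) :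
    (∑ i : V, ∑ j : V, if IsEdge 𝒯 i j then
      dualLen 𝒯 η f i j / len η f i j * (x j - x i) ^ 2 else 0)
      = ∑ i, ∑ j, ∑ k, edgeTerm 𝒯 η f x i j k := by
  refine Finset.sum_congr rfl fun i _ => Finset.sum_congr rfl fun j _ => ?_
  split_ifs with hE
  · rw [dualLen, Finset.sum_div, Finset.sum_mul]
    refine Finset.sum_congr rfl fun k _ => ?_
    unfold edgeTerm
    split_ifs with h
    · rw [hh_div_len hsymm hnn hf h]
    · simp
  · refine (Finset.sum_eq_zero fun k _ => if_neg fun h => hE ?_).symm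
    exact IsTriangle.isEdge h

lemma sum_edgeTerm_nonneg [Fintype V] {𝒯 : Finset (Finset V)} {η : V → V → ℝ}
    (hsymm : ∀ i j : V, η i j = η j i) (hnn : ∀ i j : V, IsEdge 𝒯 i j → 0 ≤ η i j)
    {f : V → ℝ} (hf : f ∈ Uset 𝒯 η) (x : V → ℝ) :
    0 ≤ ∑ i, ∑ j, ∑ k, edgeTerm 𝒯 η f x i j k := by
  have h3 : 0 ≤ ∑ i, ∑ j, ∑ k, (edgeTerm 𝒯 η f x i j k + edgeTerm 𝒯 η f x i k j
      + edgeTerm 𝒯 η f x j k i) := by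
    refine Finset.sum_nonneg fun i _ => Finset.sum_nonneg fun j _ => Finset.sum_nonneg fun k _ => ?_
    by_cases h : IsTriangle 𝒯 i j k
    · obtain ⟨ha, hb, hc⟩ := h.eta_nonneg hnn
      have h' : IsTriangle 𝒯 i k j := (isTriangle_swap_right ..).mpr h
      have h'' : IsTriangle 𝒯 j k i :=
        (isTriangle_swap_right ..).mpr ((isTriangle_swap_left ..).mpr h)
      simp only [edgeTerm, if_pos h, if_pos h', if_pos h'', triWeight]
      rw [hsymm k j, hsymm j i, hsymm k i]
      exact triangle_form_nonneg (Real.exp_pos _) (Real.exp_pos _) (Real.exp_pos _) ha hb hc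
        (h.areaSq_pos hsymm hnn hf) (x i) (x j) (x k)
    · have h' : ¬ IsTriangle 𝒯 i k j := fun h' => h ((isTriangle_swap_right ..).mp h')
      have h'' : ¬ IsTriangle 𝒯 j k i := fun h'' =>
        h ((isTriangle_swap_left ..).mp ((isTriangle_swap_right ..).mp h''))
      simp only [edgeTerm, if_neg h, if_neg h', if_neg h'']
      norm_num
  simp only [Finset.sum_add_distrib, sum_swap_right (edgeTerm 𝒯 η f x),
    sum_rotate (edgeTerm 𝒯 η f x)] at h3
  linarith

/-- The variation of an angle along a line. -/
lemma hasDerivAt_ang {𝒯 : Finset (Finset V)} {η : V → V → ℝ}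
    (hsymm : ∀ i j : V, η i j = η j i) (hnn : ∀ i j : V, IsEdge 𝒯 i j → 0 ≤ η i j)
    {p v : V → ℝ} {t : ℝ} (hf : p + t • v ∈ Uset 𝒯 η) {i j k : V} (h : IsTriangle 𝒯 i j k) :
    HasDerivAt (fun s : ℝ => ang η (p + s • v) i j k)
      (triWeight η (p + t • v) i j k * (v j - v i)
        + triWeight η (p + t • v) i k j * (v k - v i)) t := by
  obtain ⟨ha, hb, hc⟩ := h.eta_nonneg hnn
  have hd : ∀ m : V, HasDerivAt (fun s : ℝ => Real.exp ((p + s • v) m))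
      (v m * Real.exp ((p + t • v) m)) t := by
    intro m
    have := (((hasDerivAt_id t).mul_const (v m)).const_add (p m)).exp
    refine this.congr_deriv ?_
    simp [mul_comm]
  have := hasDerivAt_triAngle (hd i) (hd j) (hd k) (fun _ => Real.exp_pos _)
    (fun _ => Real.exp_pos _) (fun _ => Real.exp_pos _) ha hb hc (h.areaSq_pos hsymm hnn hf)
  unfold ang triWeight
  simp only [len_eq]
  rw [hsymm k j]
  exact this

/-- The variation of the curvature along a line, paired with its direction. -/
lemma hasDerivAt_sum_mul_K [Fintype V] {𝒯 : Finset (Finset V)} {η : V → V → ℝ}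
    (hsymm : ∀ i j : V, η i j = η j i) (hnn : ∀ i j : V, IsEdge 𝒯 i j → 0 ≤ η i j)
    {p v : V → ℝ} {t : ℝ} (hf : p + t • v ∈ Uset 𝒯 η) :
    HasDerivAt (fun s : ℝ => ∑ i, v i * K 𝒯 η (p + s • v) i)
      ((1 / 2) * ∑ i, ∑ j, ∑ k, edgeTerm 𝒯 η (p + t • v) v i j k) t := by
  set f := p + t • v with hfdef
  let D : V → V → V → ℝ := fun i j k => if IsTriangle 𝒯 i j k then
    triWeight η f i j k * (v j - v i) + triWeight η f i k j * (v k - v i) else 0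
  let H : V → V → V → ℝ := fun i j k => if IsTriangle 𝒯 i j k then
    v i * triWeight η f i j k * (v j - v i) else 0
  have hK : ∀ i, HasDerivAt (fun s : ℝ => K 𝒯 η (p + s • v) i)
      (-((1 / 2) * ∑ j, ∑ k, D i j k)) t := by
    intro i
    unfold K
    refine ((HasDerivAt.fun_sum fun j _ => HasDerivAt.fun_sum fun k _ => ?_).const_mul
      (1 / 2 : ℝ)).const_sub _
    by_cases h : IsTriangle 𝒯 i j k
    · simp only [D, if_pos h]
      exact hasDerivAt_ang hsymm hnn hf h
    · simp only [D, if_neg h]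
      exact hasDerivAt_const ..
  refine (HasDerivAt.fun_sum fun i _ => (hK i).const_mul (v i)).congr_deriv ?_
  have hD : ∀ i j k, v i * D i j k = H i j k + H i k j := by
    intro i j k
    simp only [D, H, isTriangle_swap_right 𝒯 i j k]
    split_ifs <;> ring
  have hH : ∀ i j k, H i j k + H j i k = -edgeTerm 𝒯 η f v i j k := by
    intro i j k
    simp only [H, edgeTerm, isTriangle_swap_left 𝒯 i j k, triWeight_swap_left hsymm f i j k]
    split_ifs <;> ring
  have s1 : ∑ i, v i * -((1 / 2) * ∑ j, ∑ k, D i j k) = -(1 / 2) * ∑ i, ∑ j, ∑ k, v i * D i j k := by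
    simp only [Finset.mul_sum]
    refine Finset.sum_congr rfl fun i _ => ?_
    rw [← Finset.sum_neg_distrib, Finset.mul_sum]
    refine Finset.sum_congr rfl fun j _ => ?_
    rw [← Finset.sum_neg_distrib, Finset.mul_sum]
    refine Finset.sum_congr rfl fun k _ => ?_
    ring
  have s2 : ∑ i, ∑ j, ∑ k, v i * D i j k = 2 * ∑ i, ∑ j, ∑ k, H i j k := by
    simp only [hD, Finset.sum_add_distrib, sum_swap_right H]
    ring
  have s3 : 2 * ∑ i, ∑ j, ∑ k, H i j k = -∑ i, ∑ j, ∑ k, edgeTerm 𝒯 η f v i j k := by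
    have : ∑ i, ∑ j, ∑ k, (H i j k + H j i k) = -∑ i, ∑ j, ∑ k, edgeTerm 𝒯 η f v i j k := by
      simp only [hH, Finset.sum_neg_distrib]
    rw [← this]
    simp only [Finset.sum_add_distrib, sum_swap_left H]
    ring
  rw [s1, s2, s3]
  ring

lemma isOpen_Uset (𝒯 : Finset (Finset V)) (η : V → V → ℝ) : IsOpen (Uset 𝒯 η) := by
  have hlen : ∀ i j, Continuous fun f : V → ℝ => len η f i j := by
    intro i j
    unfold len
    fun_prop
  have : Uset 𝒯 η = ⋂ T ∈ 𝒯, ⋂ i ∈ T, ⋂ j ∈ T, ⋂ k ∈ T, {f | i ≠ j → i ≠ k → j ≠ k →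
      len η f i j < len η f i k + len η f j k} := by
    ext f
    simp [Uset]
  rw [this]
  refine isOpen_biInter_finset fun T _ => isOpen_biInter_finset fun i _ =>
    isOpen_biInter_finset fun j _ => isOpen_biInter_finset fun k _ => ?_
  by_cases h : i ≠ j ∧ i ≠ k ∧ j ≠ k
  · simpa [h] using isOpen_lt (hlen i j) ((hlen i k).add (hlen j k))
  · convert isOpen_univ
    ext f
    simp only [Set.mem_ofPred_eq, Set.mem_univ, iff_true]
    tauto

/-- The derivative along a line, in terms of the partial derivatives. -/
lemma hasDerivAt_comp_line [Fintype V] {F : (V → ℝ) → ℝ} {g p v : V → ℝ} {t : ℝ}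
    (hF : DifferentiableAt ℝ F (p + t • v))
    (hg : ∀ i, HasDerivAt (fun s : ℝ => F (Function.update (p + t • v) i s)) (g i)
      ((p + t • v) i)) :
    HasDerivAt (fun s : ℝ => F (p + s • v)) (∑ i, v i * g i) t := by
  have hline : HasDerivAt (fun s : ℝ => p + s • v) v t := by
    simpa using ((hasDerivAt_id t).smul_const v).const_add p
  have hpartial : ∀ i, fderiv ℝ F (p + t • v) (Pi.single i 1) = g i := by
    intro i
    refine HasDerivAt.unique (HasFDerivAt.comp_hasDerivAt _ ?_ (hasDerivAt_update _ i _)) (hg i)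
    rw [Function.update_eq_self]
    exact hF.hasFDerivAt
  refine (hF.hasFDerivAt.comp_hasDerivAt t hline).congr_deriv ?_
  have hv := congrArg (fderiv ℝ F (p + t • v)) (pi_eq_sum_univ' v)
  rw [hv]
  simp only [map_sum, map_smul, hpartial, smul_eq_mul]

/-- A function on a convex set is convex if it is convex along all segments of the set. -/
lemma convexOn_of_convexOn_lines {E : Type*} [AddCommGroup E] [Module ℝ E] {F : E → ℝ}
    {s : Set E} (hs : Convex ℝ s)
    (h : ∀ p ∈ s, ∀ q ∈ s, ConvexOn ℝ (Set.Icc (0 : ℝ) 1) fun t => F (p + t • (q - p))) :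
    ConvexOn ℝ s F := by
  refine ⟨hs, fun p hp q hq α β hα hβ hαβ => ?_⟩
  have := (h p hp q hq).2 (Set.left_mem_Icc.mpr zero_le_one) (Set.right_mem_Icc.mpr zero_le_one)
    hα hβ hαβ
  have e : p + β • (q - p) = α • p + β • q := by
    rw [← eq_sub_iff_add_eq] at hαβ
    rw [hαβ]
    module
  simpa [e] using this

end InversiveDistance

open InversiveDistance in
/-- For the fixed inversive distance conformal structure with `η_ij ≥ 0`,
the quadratic form `Σ_{edges} (ℓ*_ij/ℓ_ij)(x_j − x_i)²` is nonnegative on `U`;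
consequently any smooth `F` with `∂F/∂f_i = K_i` is convex along every line segment
contained in `U`. -/
theorem inversive_distance_convexity {V : Type*} [Fintype V] [DecidableEq V]
    (𝒯 : Finset (Finset V)) (hcard : ∀ T ∈ 𝒯, T.card = 3)
    (η : V → V → ℝ) (hsymm : ∀ i j : V, η i j = η j i)
    (hnn : ∀ i j : V, IsEdge 𝒯 i j → 0 ≤ η i j) :
    (∀ f ∈ Uset 𝒯 η, ∀ x : V → ℝ,
      0 ≤ (1 / 2) * ∑ i : V, ∑ j : V,
        if IsEdge 𝒯 i j then
          dualLen 𝒯 η f i j / len η f i j * (x j - x i) ^ 2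
        else 0)
    ∧ ∀ F : (V → ℝ) → ℝ, ContDiffOn ℝ (⊤ : ℕ∞) F (Uset 𝒯 η) →
        (∀ f ∈ Uset 𝒯 η, ∀ i : V,
          HasDerivAt (fun s : ℝ => F (Function.update f i s)) (K 𝒯 η f i) (f i)) →
        ∀ a b : V → ℝ, a ∈ Uset 𝒯 η → b ∈ Uset 𝒯 η →
          segment ℝ a b ⊆ Uset 𝒯 η → ConvexOn ℝ (segment ℝ a b) F := by
  refine ⟨fun f hf x => ?_, fun F hF hK a b _ _ hab => ?_⟩
  · rw [edge_sum_eq hsymm hnn hf]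
    have := sum_edgeTerm_nonneg hsymm hnn hf x
    positivity
  · refine convexOn_of_convexOn_lines (convex_segment a b) fun p hp q hq => ?_
    have hU : ∀ t ∈ Set.Icc (0 : ℝ) 1, p + t • (q - p) ∈ Uset 𝒯 η := fun t ht =>
      hab ((convex_segment a b).add_smul_sub_mem hp hq ht)
    have hderiv : ∀ t ∈ Set.Icc (0 : ℝ) 1, HasDerivAt (fun s : ℝ => F (p + s • (q - p)))
        (∑ i, (q - p) i * K 𝒯 η (p + t • (q - p)) i) t := fun t ht =>
      hasDerivAt_comp_line (((hF _ (hU t ht)).contDiffAt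
        ((isOpen_Uset 𝒯 η).mem_nhds (hU t ht))).differentiableAt (by simp)) (hK _ (hU t ht))
    refine convexOn_of_hasDerivWithinAt2_nonneg (convex_Icc 0 1)
      (fun t ht => (hderiv t ht).continuousAt.continuousWithinAt)
      (fun t ht => (hderiv t (interior_subset ht)).hasDerivWithinAt)
      (fun t ht => (hasDerivAt_sum_mul_K hsymm hnn (hU t (interior_subset ht))).hasDerivWithinAt)
      fun t ht => ?_
    have := sum_edgeTerm_nonneg hsymm hnn (hU t (interior_subset ht)) (q - p)
    positivity
end

section
/- Let ℓ_ij (1 ≤ i < j ≤ 4) be the edge lengths of a nondegenerate Euclidean tetrahedron and let d be a metric on it. Fix δ ∈ ℝ and consider the variation ℓ₁₂(t) = ℓ₁₂, ℓ₁₃(t) = ℓ₁₃, ℓ₂₃(t) = ℓ₂₃, ℓ₁₄(t) = ℓ₁₄ + t d₄₁ δ, ℓ₂₄(t) = ℓ₂₄ + t d₄₂ δ, ℓ₃₄(t) = ℓ₃₄ + t d₄₃ δ. Then at t = 0, (d/dt) β_{12,34} = (h_{124,3} / (ℓ₁₄ sin γ_{1,24})) δ. -/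
/-- The dihedral angle `β_{ij,kl}` at the edge `{i,j}` of the tetrahedron `{i,j,k,l}`
with edge lengths `a = ℓ_ij`, `b = ℓ_ik`, `c = ℓ_il`, `p = ℓ_jk`, `q = ℓ_jl`,
`r = ℓ_kl`, via the spherical law of cosines:
`β_{ij,kl} = arccos((cos γ_{i,kl} − cos γ_{i,jk} cos γ_{i,jl})/(sin γ_{i,jk} sin γ_{i,jl}))`. -/
noncomputable def dihedralAngle (a b c p q r : ℝ) : ℝ :=
  Real.arccos ((Real.cos (triAngle b c r)
      - Real.cos (triAngle a b p) * Real.cos (triAngle a c q)) /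
    (Real.sin (triAngle a b p) * Real.sin (triAngle a c q)))

/-- `h_{ij,k} = (d_ik − d_ij cos γ_{i,jk})/sin γ_{i,jk}` as a function of `d_ik`,
`d_ij` and `γ = γ_{i,jk}`. -/
noncomputable def hFace (dik dij γ : ℝ) : ℝ := (dik - dij * Real.cos γ) / Real.sin γ

/-- `h_{ijk,l} = (h_{ij,l} − h_{ij,k} cos β_{ij,kl})/sin β_{ij,kl}` as a function of
`h_{ij,l}`, `h_{ij,k}` and `β = β_{ij,kl}`. -/
noncomputable def hTet (hijl hijk β : ℝ) : ℝ := (hijl - hijk * Real.cos β) / Real.sin β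

/-- The Cayley–Menger determinant of a tetrahedron with edge lengths
`a = ℓ₁₂`, `b = ℓ₁₃`, `c = ℓ₁₄`, `p = ℓ₂₃`, `q = ℓ₂₄`, `r = ℓ₃₄`. -/
noncomputable def cmDet (a b c p q r : ℝ) : ℝ :=
  Matrix.det !![(0 : ℝ), 1, 1, 1, 1;
    1, 0, a ^ 2, b ^ 2, c ^ 2;
    1, a ^ 2, 0, p ^ 2, q ^ 2;
    1, b ^ 2, p ^ 2, 0, r ^ 2;
    1, c ^ 2, q ^ 2, r ^ 2, 0]

/-- Heron's formula for the area of a triangle with side lengths `a`, `b`, `c`. -/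
noncomputable def heronArea (a b c : ℝ) : ℝ :=
  Real.sqrt ((a + b + c) * (-a + b + c) * (a - b + c) * (a + b - c)) / 4

theorem cos_arccos_of_sq_lt_one {x : ℝ} (h : 0 < 1 - x ^ 2) :
    Real.cos (Real.arccos x) = x :=
  Real.cos_arccos (by nlinarith) (by nlinarith)

/-- The cosine of the angle between the sides `a`, `b` of a triangle with third side `c`. -/
noncomputable def triCos (a b c : ℝ) : ℝ := (a ^ 2 + b ^ 2 - c ^ 2) / (2 * a * b)

theorem cos_triAngle_s9 {a b c : ℝ} (h : 0 < 1 - triCos a b c ^ 2) :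
    Real.cos (triAngle a b c) = triCos a b c :=
  cos_arccos_of_sq_lt_one h

theorem sin_triAngle_s9 (a b c : ℝ) :
    Real.sin (triAngle a b c) = √(1 - triCos a b c ^ 2) :=
  Real.sin_arccos _

/-- The Cayley–Menger determinant in terms of the Gram determinant of the unit edge vectors
at the first vertex. -/
theorem cmDet_eq {a b c p q r : ℝ} (ha : 0 < a) (hb : 0 < b) (hc : 0 < c) :
    cmDet a b c p q r = 8 * (a * b * c) ^ 2 *
      (1 + 2 * triCos a b p * triCos a c q * triCos b c r
        - triCos a b p ^ 2 - triCos a c q ^ 2 - triCos b c r ^ 2) := by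
  unfold cmDet triCos
  simp [Matrix.det_succ_row_zero, Fin.sum_univ_succ, Fin.succAbove]
  field_simp
  ring

/-- First variation of the angle cosine at a vertex of a triangle with a metric, the
opposite vertex of the fixed side `b` being moved. -/
theorem hasDerivAt_triCos {b c r d13 d31 d14 d41 d34 d43 : ℝ} (hb : 0 < b) (hc : 0 < c)
    (hs13 : d13 + d31 = b) (hs14 : d14 + d41 = c) (hs34 : d34 + d43 = r)
    (hm : d13 ^ 2 + d34 ^ 2 + d41 ^ 2 = d31 ^ 2 + d43 ^ 2 + d14 ^ 2) (δ : ℝ) :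
    HasDerivAt (fun t : ℝ => triCos b (c + t * (d41 * δ)) (r + t * (d43 * δ)))
      (-(d13 - d14 * triCos b c r) / c * δ) 0 := by
  have hlin (x y : ℝ) : HasDerivAt (fun t : ℝ => x + t * y) y 0 := by
    simpa using ((hasDerivAt_id (0 : ℝ)).mul_const y).const_add x
  have hnum := (((hlin c (d41 * δ)).pow 2).const_add (b ^ 2)).sub ((hlin r (d43 * δ)).pow 2)
  have hden := (hlin c (d41 * δ)).const_mul (2 * b)
  have hne : 2 * b * (c + 0 * (d41 * δ)) ≠ 0 := by
    rw [zero_mul, add_zero]; positivity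
  refine (hnum.div hden hne).congr_deriv ?_
  simp only [triCos, zero_mul, add_zero, Pi.pow_apply, Pi.sub_apply]
  obtain rfl : d31 = b - d13 := by linarith
  obtain rfl : d41 = c - d14 := by linarith
  obtain rfl : d34 = r - d43 := by linarith
  field_simp
  norm_num
  linear_combination (δ * c) * hm

theorem HasDerivAt.cos_arccos {f : ℝ → ℝ} {f' x : ℝ} (hf : HasDerivAt f f' x)
    (h : 0 < 1 - f x ^ 2) : HasDerivAt (fun t => Real.cos (Real.arccos (f t))) f' x := by
  refine hf.congr_of_eventuallyEq ?_
  have hcont : ContinuousAt (fun t => 1 - f t ^ 2) x :=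
    continuousAt_const.sub (hf.continuousAt.pow 2)
  filter_upwards [hcont.eventually (lt_mem_nhds h)] with t ht
  exact cos_arccos_of_sq_lt_one ht

/-- First variation of the angle of a spherical triangle given by the cosines of its sides,
one of the sides adjacent to the angle being fixed. -/
theorem hasDerivAt_arccos_sphericalCos {X Y : ℝ → ℝ} {X' Y' t₀ s u : ℝ}
    (hX : HasDerivAt X X' t₀) (hY : HasDerivAt Y Y' t₀) (hs : 0 < s)
    (hy : 0 < 1 - Y t₀ ^ 2)
    (hF : 0 < 1 - ((X t₀ - u * Y t₀) / (s * √(1 - Y t₀ ^ 2))) ^ 2) :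
    HasDerivAt (fun t => Real.arccos ((X t - u * Y t) / (s * √(1 - Y t ^ 2))))
      (-((X' - u * Y' + (X t₀ - u * Y t₀) * Y t₀ * Y' / (1 - Y t₀ ^ 2)) /
        (s * √(1 - Y t₀ ^ 2))) /
        √(1 - ((X t₀ - u * Y t₀) / (s * √(1 - Y t₀ ^ 2))) ^ 2)) t₀ := by
  have hw := Real.sqrt_pos.2 hy
  have hw2 := Real.sq_sqrt hy.le
  have hdF := (hX.sub (hY.const_mul u)).div ((((hY.pow 2).const_sub 1).sqrt hy.ne').const_mul s)
    (by simp only [Pi.pow_apply]; positivity)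
  have hne (z : ℝ) (hz : z ^ 2 = 1) : (X t₀ - u * Y t₀) / (s * √(1 - Y t₀ ^ 2)) ≠ z := by
    rintro rfl
    exact hF.ne' (sub_eq_zero.2 hz.symm)
  refine ((Real.hasDerivAt_arccos (hne (-1) (by norm_num)) (hne 1 (by norm_num))).comp
    t₀ hdF).congr_deriv ?_
  have hR := Real.sqrt_pos.2 hF
  simp only [Pi.sub_apply, Pi.pow_apply]
  generalize √(1 - ((X t₀ - u * Y t₀) / (s * √(1 - Y t₀ ^ 2))) ^ 2) = R at hR ⊢
  generalize √(1 - Y t₀ ^ 2) = w at hw hw2 ⊢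
  rw [← hw2]
  field_simp
  norm_num
  ring

/-- For a nondegenerate tetrahedron with a metric `d`, under the variation
`ℓ₁₄(t) = ℓ₁₄ + t d₄₁ δ`, `ℓ₂₄(t) = ℓ₂₄ + t d₄₂ δ`, `ℓ₃₄(t) = ℓ₃₄ + t d₄₃ δ`
(the face `{1,2,3}` fixed), at `t = 0`:
`(d/dt) β_{12,34} = (h_{124,3} / (ℓ₁₄ sin γ_{1,24})) δ`. -/
theorem dihedral_angle_variation
    (l12 l13 l14 l23 l24 l34 : ℝ)
    (hp12 : 0 < l12) (hp13 : 0 < l13) (hp14 : 0 < l14)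
    (hp23 : 0 < l23) (hp24 : 0 < l24) (hp34 : 0 < l34)
    (hnd : 0 < cmDet l12 l13 l14 l23 l24 l34)
    (d12 d21 d13 d31 d14 d41 d23 d32 d24 d42 d34 d43 : ℝ)
    (hs12 : d12 + d21 = l12) (hs13 : d13 + d31 = l13) (hs14 : d14 + d41 = l14)
    (hs23 : d23 + d32 = l23) (hs24 : d24 + d42 = l24) (hs34 : d34 + d43 = l34)
    (hm123 : d12 ^ 2 + d23 ^ 2 + d31 ^ 2 = d21 ^ 2 + d32 ^ 2 + d13 ^ 2)
    (hm124 : d12 ^ 2 + d24 ^ 2 + d41 ^ 2 = d21 ^ 2 + d42 ^ 2 + d14 ^ 2)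
    (hm134 : d13 ^ 2 + d34 ^ 2 + d41 ^ 2 = d31 ^ 2 + d43 ^ 2 + d14 ^ 2)
    (hm234 : d23 ^ 2 + d34 ^ 2 + d42 ^ 2 = d32 ^ 2 + d43 ^ 2 + d24 ^ 2)
    (δ : ℝ) :
    let γ123 := triAngle l12 l13 l23      -- γ_{1,23}
    let γ124 := triAngle l12 l14 l24      -- γ_{1,24}
    let β1234 := dihedralAngle l12 l13 l14 l23 l24 l34  -- β_{12,34}
    let h123 := hFace d13 d12 γ123        -- h_{12,3}
    let h124 := hFace d14 d12 γ124        -- h_{12,4}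
    let h1243 := hTet h123 h124 β1234     -- h_{124,3}
    HasDerivAt
      (fun t : ℝ => dihedralAngle l12 l13 (l14 + t * (d41 * δ)) l23
        (l24 + t * (d42 * δ)) (l34 + t * (d43 * δ)))
      (h1243 / (l14 * Real.sin γ124) * δ) 0 := by
  intro γ123 γ124 β1234 h123 h124 h1243
  set u := triCos l12 l13 l23 with hu
  set y := triCos l12 l14 l24 with hy
  set x := triCos l13 l14 l34 with hx
  have hgram : 0 < 1 + 2 * u * y * x - u ^ 2 - y ^ 2 - x ^ 2 := by
    rw [cmDet_eq hp12 hp13 hp14] at hnd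
    exact pos_of_mul_pos_right hnd (by positivity)
  have hprod : (x - u * y) ^ 2 < (1 - u ^ 2) * (1 - y ^ 2) := by linarith
  have hprod' : (u - x * y) ^ 2 < (1 - x ^ 2) * (1 - y ^ 2) := by linarith
  have hsu : Real.sin γ123 = √(1 - u ^ 2) := sin_triAngle_s9 _ _ _
  have hsy : Real.sin γ124 = √(1 - y ^ 2) := sin_triAngle_s9 _ _ _
  rcases le_or_gt (1 - y ^ 2) 0 with hy0 | hy0
  · have hu0 : 1 - u ^ 2 ≤ 0 := by
      by_contra! hu0
      nlinarith [sq_nonneg (x - u * y), mul_nonneg hu0.le (neg_nonneg.2 hy0)]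
    rw [Real.sqrt_eq_zero_of_nonpos hy0] at hsy
    rw [Real.sqrt_eq_zero_of_nonpos hu0] at hsu
    have hsu' : Real.sin (triAngle l12 l13 l23) = 0 := hsu
    simpa [dihedralAngle, hsu', hsy] using hasDerivAt_const (0 : ℝ) (Real.arccos 0)
  have hu0 : 0 < 1 - u ^ 2 :=
    pos_of_mul_pos_left ((sq_nonneg _).trans_lt hprod) hy0.le
  have hx0 : 0 < 1 - x ^ 2 :=
    pos_of_mul_pos_left ((sq_nonneg _).trans_lt hprod') hy0.le
  have hcu : Real.cos γ123 = u := cos_triAngle_s9 hu0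
  have hcy : Real.cos γ124 = y := cos_triAngle_s9 hy0
  have hcx : Real.cos (triAngle l13 l14 l34) = x := cos_triAngle_s9 hx0
  set s := √(1 - u ^ 2) with hs
  set w := √(1 - y ^ 2) with hw
  have hs0 : 0 < s := Real.sqrt_pos.2 hu0
  have hw0 : 0 < w := Real.sqrt_pos.2 hy0
  have hs2 : s ^ 2 = 1 - u ^ 2 := Real.sq_sqrt hu0.le
  have hw2 : w ^ 2 = 1 - y ^ 2 := Real.sq_sqrt hy0.le
  set F := (x - u * y) / (s * w) with hF
  have hF2 : 0 < 1 - F ^ 2 := by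
    rw [hF, div_pow, mul_pow, hs2, hw2, sub_pos, div_lt_one (by positivity)]
    exact hprod
  have hβ : β1234 = Real.arccos F := by
    change Real.arccos ((Real.cos (triAngle l13 l14 l34) - Real.cos γ123 * Real.cos γ124) /
      (Real.sin γ123 * Real.sin γ124)) = _
    rw [hcu, hcy, hcx, hsu, hsy]
  have hcβ : Real.cos β1234 = F := by
    rw [hβ, cos_arccos_of_sq_lt_one hF2]
  have hsβ : Real.sin β1234 = √(1 - F ^ 2) := by rw [hβ, Real.sin_arccos]
  have hdx := hasDerivAt_triCos hp13 hp14 hs13 hs14 hs34 hm134 δ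
  have hdy := hasDerivAt_triCos hp12 hp14 hs12 hs14 hs24 hm124 δ
  rw [← hx] at hdx
  rw [← hy] at hdy
  have hx_zero : triCos l13 (l14 + 0 * (d41 * δ)) (l34 + 0 * (d43 * δ)) = x := by simp [hx]
  have hy_zero : triCos l12 (l14 + 0 * (d41 * δ)) (l24 + 0 * (d42 * δ)) = y := by simp [hy]
  have hdcx := hdx.cos_arccos (by rw [hx_zero]; exact hx0)
  have hdcy := hdy.cos_arccos (by rw [hy_zero]; exact hy0)
  have hdβ := hasDerivAt_arccos_sphericalCos (u := u) hdcx hdcy hs0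
    (by rwa [hy_zero, cos_arccos_of_sq_lt_one hy0])
    (by rwa [hx_zero, hy_zero, cos_arccos_of_sq_lt_one hx0, cos_arccos_of_sq_lt_one hy0])
  rw [hx_zero, hy_zero, cos_arccos_of_sq_lt_one hx0, cos_arccos_of_sq_lt_one hy0] at hdβ
  refine (hdβ.congr_of_eventuallyEq (Filter.Eventually.of_forall fun t => ?_)).congr_deriv ?_
  · change Real.arccos ((_ - Real.cos γ123 * _) / (Real.sin γ123 * _)) = _
    rw [hcu, hsu, Real.sin_eq_sqrt_one_sub_cos_sq (x := triAngle l12 _ _)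
      (Real.arccos_nonneg _) (Real.arccos_le_pi _)]
    rfl
  · simp only [h1243, h123, h124, hTet, hFace, hcβ, hsβ, hcu, hcy, hsu, hsy]
    rw [← hw, ← hF]
    have hR : 0 < √(1 - F ^ 2) := Real.sqrt_pos.2 hF2
    generalize √(1 - F ^ 2) = R at hR ⊢
    rw [hF, ← hw2]
    field_simp
    rw [hw2]
    ring
end
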